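/- arXiv:2206.11151 — 6 statements merged into one kernel-verified Lean document; each statement's English description precedes it below -/
import Mathlib

section
/- Let Γ be a finitely generated residually finite group (equipped with the word metric of a finite generating set) that admits a coarse embedding into a real Hilbert space. Then for every filtration (Γᵢ) of Γ, the box space □_{(Γᵢ)}(Γ) admits a coarse embedding at infinity into Hilbert space. -/
open Metric Bornology Filter

/-- The metric on a group `G` is the word metric of the finite generating set `S`:
`S` generates `G` and `dist g h` is the least length of a word in `S ∪ S⁻¹` whose
product is `g⁻¹ * h`. -/
def IsWordMetric (G : Type*) [Group G] [MetricSpace G] (S : Finset G) : Prop :=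
  Subgroup.closure (S : Set G) = ⊤ ∧
  ∀ g h : G, dist g h =
    sInf {r : ℝ | ∃ l : List G, (∀ x ∈ l, x ∈ S ∨ x⁻¹ ∈ S) ∧ l.prod = g⁻¹ * h ∧
      r = (l.length : ℝ)}

/-- `X` admits a coarse embedding into a real Hilbert space. -/
def CoarseEmbHilbert (X : Type*) [MetricSpace X] : Prop :=
  ∃ (H : Type) (_ : NormedAddCommGroup H) (_ : InnerProductSpace ℝ H) (_ : CompleteSpace H)
    (f : X → H) (ρm ρp : ℝ → ℝ),
    Monotone ρm ∧ Monotone ρp ∧ Tendsto ρm atTop atTop ∧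
    ∀ x y : X, ρm (dist x y) ≤ ‖f x - f y‖ ∧ ‖f x - f y‖ ≤ ρp (dist x y)

/-- `X` admits a coarse embedding at infinity into Hilbert space. -/
def CoarseEmbAtInfinityHilbert (X : Type*) [MetricSpace X] : Prop :=
  ∃ ρm ρp : ℝ → ℝ,
    Monotone ρm ∧ Monotone ρp ∧
    Tendsto ρm atTop atTop ∧ Tendsto ρp atTop atTop ∧
    ∀ R : ℝ, 0 < R → ∃ K : Set X, IsBounded K ∧
      ∀ C : Set X, IsBounded C → C ⊆ Kᶜ → diam C ≤ R →
        ∃ (H : Type) (_ : NormedAddCommGroup H) (_ : InnerProductSpace ℝ H)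
          (_ : CompleteSpace H) (f : C → H),
          ∀ x y : C, ρm (dist (x : X) (y : X)) ≤ ‖f x - f y‖ ∧
            ‖f x - f y‖ ≤ ρp (dist (x : X) (y : X))

section WordMetric

variable {G : Type*} [Group G] [MetricSpace G] {S : Finset G}

theorem IsWordMetric.dist_mul_left (hS : IsWordMetric G S) (k g h : G) :
    dist (k * g) (k * h) = dist g h := by
  rw [hS.2, hS.2, show (k * g)⁻¹ * (k * h) = g⁻¹ * h by group]

theorem IsWordMetric.exists_word (hS : IsWordMetric G S) (g : G) :
    ∃ l : List G, (∀ x ∈ l, x ∈ S ∨ x⁻¹ ∈ S) ∧ l.prod = g := by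
  have hg : g ∈ Subgroup.closure (S : Set G) := hS.1 ▸ Subgroup.mem_top g
  rw [← Subgroup.mem_toSubmonoid, Subgroup.closure_toSubmonoid] at hg
  obtain ⟨l, hl, rfl⟩ := Submonoid.exists_list_of_mem_closure hg
  exact ⟨l, fun x hx => by simpa using hl x hx, rfl⟩

/-- Balls of a word metric are finite. -/
theorem IsWordMetric.finite_dist_one_lt (hS : IsWordMetric G S) (r : ℝ) :
    {g : G | dist 1 g < r}.Finite := by
  let T : Set G := {x | x ∈ S ∨ x⁻¹ ∈ S}
  have hT : T.Finite := by
    have h : T = (S : Set G) ∪ (S : Set G)⁻¹ := by ext; simp [T]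
    rw [h]
    exact S.finite_toSet.union S.finite_toSet.inv
  have : Finite T := hT
  refine ((List.finite_length_lt T (⌈r⌉₊)).image
    fun l => (l.map Subtype.val).prod).subset ?_
  intro g hg
  have hg : dist 1 g < r := hg
  rw [hS.2] at hg
  obtain ⟨l₀, hl₀, hp₀⟩ := hS.exists_word (1⁻¹ * g)
  obtain ⟨_, ⟨l, hl, hp, rfl⟩, hlt⟩ := exists_lt_of_csInf_lt (by exact ⟨_, l₀, hl₀, hp₀, rfl⟩) hg
  refine ⟨l.attachWith (· ∈ T) hl, ?_, ?_⟩
  · simpa using Nat.lt_ceil.2 hlt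
  · simpa using hp

/-- A filtration eventually avoids every ball of a word metric, apart from the identity. -/
theorem IsWordMetric.eventually_eq_one (hS : IsWordMetric G S) {N : ℕ → Subgroup G}
    (hanti : Antitone N) (hinter : (⨅ n, N n) = ⊥) (r : ℝ) :
    ∀ᶠ n in atTop, ∀ g : G, dist 1 g < r → g ∈ N n → g = 1 := by
  refine (eventually_all_finite (hS.finite_dist_one_lt r)).2 fun g _ => ?_
  by_cases hg : g = 1
  · exact Eventually.of_forall fun _ _ => hg
  · obtain ⟨m, hm⟩ : ∃ m, g ∉ N m := by
      by_contra! h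
      exact hg (Subgroup.mem_bot.1 (hinter ▸ Subgroup.mem_iInf.2 h))
    filter_upwards [eventually_ge_atTop m] with n hn hgn
    exact absurd (hanti hn hgn) hm

/-- For a normal subgroup, any representative of the first coset may be fixed when the quotient
distance is approximated. -/
theorem IsWordMetric.exists_dist_mul_lt (hS : IsWordMetric G S) {N : Subgroup G} [N.Normal]
    {g h : G} {t : ℝ}
    (ht : sInf {r : ℝ | ∃ a ∈ N, ∃ b ∈ N, r = dist (g * a) (h * b)} < t) :
    ∃ c ∈ N, dist g (h * c) < t := by
  obtain ⟨_, ⟨a, ha, b, hb, rfl⟩, hlt⟩ :=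
    exists_lt_of_csInf_lt (by exact ⟨_, 1, N.one_mem, 1, N.one_mem, rfl⟩) ht
  refine ⟨h⁻¹ * (g * a⁻¹ * g⁻¹) * h * b, N.mul_mem ?_ hb, ?_⟩
  · simpa using ‹N.Normal›.conj_mem _ (‹N.Normal›.conj_mem _ (N.inv_mem ha) g) h⁻¹
  · refine lt_of_eq_of_lt ?_ hlt
    rw [← hS.dist_mul_left (g * a⁻¹ * g⁻¹) (g * a)]
    congr 1 <;> group

/-- The quotient metric agrees with the word metric on representatives that are close together
compared to the shortest nontrivial element of the subgroup. -/
theorem IsWordMetric.sInf_dist_eq (hS : IsWordMetric G S) {N : Subgroup G} [N.Normal]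
    {r t : ℝ} (hN : ∀ g : G, dist 1 g < r + t → g ∈ N → g = 1) {g h : G}
    (hgh : dist g h < r)
    (ht : sInf {r : ℝ | ∃ a ∈ N, ∃ b ∈ N, r = dist (g * a) (h * b)} < t) :
    sInf {r : ℝ | ∃ a ∈ N, ∃ b ∈ N, r = dist (g * a) (h * b)} = dist g h := by
  apply le_antisymm
  · refine csInf_le ⟨0, ?_⟩ ⟨1, N.one_mem, 1, N.one_mem, by simp⟩
    rintro _ ⟨a, _, b, _, rfl⟩
    exact dist_nonneg
  · refine le_of_forall_gt fun u hu => ?_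
    obtain ⟨c, hc, hlt⟩ := hS.exists_dist_mul_lt (lt_min hu ht)
    have h1 : dist 1 c < r + t := by
      rw [← hS.dist_mul_left h, mul_one]
      have := dist_triangle_left h (h * c) g
      linarith [min_le_right u t]
    rw [hN c h1 hc, mul_one] at hlt
    exact hlt.trans_le (min_le_left _ _)

end WordMetric

/-- Theorem 2.3, (1) ⇒ (3): if a finitely generated residually finite group `Γ`
(with the word metric of a finite generating set) coarsely embeds into Hilbert space,
then for every filtration `(N n)` the box space `⊔ₙ Γ/Γₙ` (a metric on the disjoint union
restricting to the quotient metric on each block, with blocks drifting to infinity)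
admits a coarse embedding at infinity into Hilbert space. -/
theorem box_space_coarse_emb_at_infinity
    {Γ : Type*} [Group Γ] [MetricSpace Γ] (S : Finset Γ) (hword : IsWordMetric Γ S)
    (hCE : CoarseEmbHilbert Γ)
    -- a filtration of Γ
    (N : ℕ → Subgroup Γ) [∀ n, (N n).Normal] [∀ n, (N n).FiniteIndex]
    (hanti : Antitone N) (hinter : (⨅ n, N n) = ⊥)
    -- the box space: a metric on the disjoint union of the quotients
    [MetricSpace ((n : ℕ) × (Γ ⧸ N n))]
    -- whose restriction to each block is the quotient metric
    (hrest : ∀ (n : ℕ) (g h : Γ),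
      dist (⟨n, QuotientGroup.mk g⟩ : (n : ℕ) × (Γ ⧸ N n)) ⟨n, QuotientGroup.mk h⟩ =
        sInf {r : ℝ | ∃ a ∈ N n, ∃ b ∈ N n, r = dist (g * a) (h * b)})
    -- and whose blocks drift apart towards infinity
    (hsep : ∀ M : ℝ, ∃ n₀ : ℕ, ∀ i j : ℕ, i ≠ j → n₀ ≤ i + j →
      ∀ (x : Γ ⧸ N i) (y : Γ ⧸ N j),
        M ≤ dist (⟨i, x⟩ : (n : ℕ) × (Γ ⧸ N n)) ⟨j, y⟩) :
    CoarseEmbAtInfinityHilbert ((n : ℕ) × (Γ ⧸ N n)) := by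
  obtain ⟨H, _, _, _, f, ρm, ρp, hm, hp, hmt, hf⟩ := hCE
  refine ⟨ρm, fun t => max (ρp t) t, hm, hp.sup monotone_id, hmt,
    tendsto_atTop_mono (fun t => le_max_right _ _) tendsto_id, fun R _ => ?_⟩
  obtain ⟨n₀, hn₀⟩ := hsep (R + 1)
  obtain ⟨n₁, hn₁⟩ := eventually_atTop.1
    (hword.eventually_eq_one hanti hinter (((R + 1) + (R + 1)) + (R + 1)))
  have hK : {x : (n : ℕ) × (Γ ⧸ N n) | x.1 < max n₀ n₁}.Finite := by
    refine ((Set.finite_lt_nat (max n₀ n₁)).biUnion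
      fun n _ => Set.finite_range (Sigma.mk (β := fun n => Γ ⧸ N n) n)).subset ?_
    rintro ⟨n, x⟩ hx
    exact Set.mem_biUnion hx ⟨x, rfl⟩
  refine ⟨_, hK.isBounded, fun C hC hCK hdiam => ⟨H, _, ‹_›, ‹_›, ?_⟩⟩
  have hdist : ∀ x ∈ C, ∀ y ∈ C, dist x y < R + 1 := fun x hx y hy =>
    ((dist_le_diam_of_mem hC hx hy).trans hdiam).trans_lt (lt_add_one R)
  rcases C.eq_empty_or_nonempty with rfl | ⟨⟨n, q⟩, hq⟩
  · exact ⟨fun _ => 0, fun x => x.2.elim⟩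
  have hn : max n₀ n₁ ≤ n := not_lt.1 (hCK hq)
  obtain ⟨g₀, rfl⟩ := QuotientGroup.mk_surjective q
  have hlift : ∀ x : C, ∃ g : Γ, (x : (n : ℕ) × (Γ ⧸ N n)) = ⟨n, QuotientGroup.mk g⟩ ∧
      dist g₀ g < R + 1 := by
    rintro ⟨⟨k, p⟩, hx⟩
    obtain rfl : n = k := by
      by_contra hne
      exact (hdist _ hq _ hx).not_ge
        (hn₀ n k hne (((le_max_left _ _).trans hn).trans (Nat.le_add_right _ _)) _ _)
    obtain ⟨h, rfl⟩ := QuotientGroup.mk_surjective p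
    have hlt := hdist _ hq _ hx
    rw [hrest] at hlt
    obtain ⟨c, hc, hlt⟩ := hword.exists_dist_mul_lt hlt
    refine ⟨h * c, ?_, hlt⟩
    rw [QuotientGroup.mk_mul_of_mem h hc]
  choose s hs hs₀ using hlift
  refine ⟨fun x => f (s x), fun x y => ?_⟩
  have hxy : dist (x : (n : ℕ) × (Γ ⧸ N n)) y = dist (s x) (s y) := by
    have hlt := hdist _ x.2 _ y.2
    rw [hs x, hs y, hrest] at hlt ⊢
    refine hword.sInf_dist_eq (hn₁ n ((le_max_right _ _).trans hn)) ?_ hlt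
    exact (dist_triangle_left _ _ g₀).trans_lt (add_lt_add (hs₀ x) (hs₀ y))
  rw [hxy]
  exact ⟨(hf _ _).1, (hf _ _).2.trans (le_max_left _ _)⟩
end

section
/- Let Γ be a finitely generated residually finite group (equipped with the word metric of a finite generating set). If for some filtration (Γᵢ) of Γ the box space □_{(Γᵢ)}(Γ) admits a coarse embedding at infinity into Hilbert space, then Γ admits a coarse embedding into a real Hilbert space. -/
open Metric Bornology Filter

open scoped Topology

/-- A real symmetric kernel of positive type on `X : Type` is the Gram kernel of a family of vectors
in a Hilbert space. -/
theorem exists_gram_of_posType {X : Type} (G : X → X → ℝ) (hsymm : ∀ x y, G x y = G y x)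
    (hpos : ∀ v : X →₀ ℝ, 0 ≤ v.sum fun x a => v.sum fun y b => a * b * G x y) :
    ∃ (H : Type) (_ : NormedAddCommGroup H) (_ : InnerProductSpace ℝ H) (_ : CompleteSpace H)
      (φ : X → H), ∀ x y, inner ℝ (φ x) (φ y) = G x y := by
  let K : Matrix X X (ℝ →L[ℝ] ℝ) := Matrix.of fun x y => G x y • (1 : ℝ →L[ℝ] ℝ)
  have hK : K.PosSemidef := by
    have hiff := (RKHS.posSemidef_tfae (K := K)).out 0 2
    rw [hiff]
    refine ⟨?_, fun v => ?_⟩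
    · ext x y
      simp [K, hsymm x y]
    · convert hpos v using 1
      simp only [RCLike.re_to_real]
      refine Finsupp.sum_congr fun x _ => Finsupp.sum_congr fun y _ => ?_
      simp [K, hsymm x y]
      ring
  have : Fact K.PosSemidef := ⟨hK⟩
  refine ⟨RKHS.OfKernel K, inferInstance, inferInstance, inferInstance,
    fun x => RKHS.kerFun (RKHS.OfKernel K) x 1, fun x y => ?_⟩
  rw [← RKHS.kernel_inner, RKHS.OfKernel.kernel_ofKernel]
  simp [K, hsymm x y]

/-- Maps into Hilbert spaces that satisfy two-sided distance bounds on sets exhausting a countable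
set have a limit satisfying the same bounds everywhere. -/
theorem exists_limit_map_hilbert {X : Type*} [Countable X] (lo hi : X → X → ℝ) (B : ℕ → Set X)
    (hB : ∀ x, ∀ᶠ n in atTop, x ∈ B n)
    (h : ∀ n, ∃ (H : Type) (_ : NormedAddCommGroup H) (_ : InnerProductSpace ℝ H) (f : X → H),
      ∀ x ∈ B n, ∀ y ∈ B n, lo x y ≤ ‖f x - f y‖ ∧ ‖f x - f y‖ ≤ hi x y) :
    ∃ (H : Type) (_ : NormedAddCommGroup H) (_ : InnerProductSpace ℝ H) (_ : CompleteSpace H)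
      (f : X → H), ∀ x y, lo x y ≤ ‖f x - f y‖ ∧ ‖f x - f y‖ ≤ hi x y := by
  rcases isEmpty_or_nonempty X with hX | ⟨⟨o⟩⟩
  · exact ⟨ℝ, inferInstance, inferInstance, inferInstance, fun _ => 0, fun x => hX.elim x⟩
  choose H i₁ i₂ f hf using h
  let g (n : ℕ) (x y : X) : ℝ := inner ℝ (f n x - f n o) (f n y - f n o)
  let U : Ultrafilter ℕ := hyperfilter ℕ
  have hU : (U : Filter ℕ) ≤ atTop := by
    rw [← Nat.cofinite_eq_atTop]; exact hyperfilter_le_cofinite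
  have hlim (x y : X) : ∃ c, Tendsto (fun n => g n x y) U (𝓝 c) := by
    have hev : ∀ᶠ n in (U : Filter ℕ),
        g n x y ∈ Set.Icc (-(hi x o * hi y o)) (hi x o * hi y o) := by
      filter_upwards [hU (hB x), hU (hB y), hU (hB o)] with n hx hy ho
      have h1 := (hf n x hx o ho).2
      have h2 := (hf n y hy o ho).2
      rw [Set.mem_Icc, ← abs_le]
      exact (abs_real_inner_le_norm _ _).trans
        (mul_le_mul h1 h2 (norm_nonneg _) ((norm_nonneg _).trans h1))
    obtain ⟨c, -, hc⟩ := isCompact_Icc.ultrafilter_le_nhds' (U.map fun n => g n x y) hev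
    exact ⟨c, hc⟩
  choose G hG using hlim
  have hsymm (x y : X) : G x y = G y x := by
    refine tendsto_nhds_unique (hG x y) ((hG y x).congr fun n => ?_)
    exact real_inner_comm _ _
  let e := equivShrink.{0} X
  obtain ⟨E, j₁, j₂, j₃, φ, hφ⟩ := exists_gram_of_posType
    (fun x y => G (e.symm x) (e.symm y)) (fun x y => hsymm _ _) (fun v => by
      have ht : Tendsto (fun n => v.sum fun x a => v.sum fun y b =>
          a * b * g n (e.symm x) (e.symm y)) U
          (𝓝 (v.sum fun x a => v.sum fun y b => a * b * G (e.symm x) (e.symm y))) := by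
        refine tendsto_finsetSum _ fun x _ => tendsto_finsetSum _ fun y _ => ?_
        exact (hG _ _).const_mul _
      refine ge_of_tendsto' ht fun n => ?_
      have : (v.sum fun x a => v.sum fun y b => a * b * g n (e.symm x) (e.symm y)) =
          inner ℝ (v.sum fun x a => a • (f n (e.symm x) - f n o))
            (v.sum fun x a => a • (f n (e.symm x) - f n o)) := by
        simp only [Finsupp.sum, sum_inner, inner_sum, real_inner_smul_left,
          real_inner_smul_right, g, mul_assoc]
        rw [Finset.sum_comm]
        refine Finset.sum_congr rfl fun x _ => Finset.sum_congr rfl fun y _ => ?_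
        ring
      rw [this]
      exact real_inner_self_nonneg)
  refine ⟨E, j₁, j₂, j₃, fun x => φ (e x), fun x y => ?_⟩
  have hnorm : Tendsto (fun n => ‖f n x - f n y‖) U (𝓝 ‖φ (e x) - φ (e y)‖) := by
    have ht : Tendsto (fun n => √(g n x x - 2 * g n x y + g n y y)) U
        (𝓝 √(G x x - 2 * G x y + G y y)) :=
      (((hG x x).sub ((hG x y).const_mul 2)).add (hG y y)).sqrt
    convert ht using 2 with n
    · rw [← sub_sub_sub_cancel_right (f n x) (f n y) (f n o),
        ← Real.sqrt_sq (norm_nonneg (f n x - f n o - (f n y - f n o))), norm_sub_sq_real]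
      simp only [g, real_inner_self_eq_norm_sq]
    · rw [← Real.sqrt_sq (norm_nonneg (φ (e x) - φ (e y))), norm_sub_sq_real]
      simp only [← real_inner_self_eq_norm_sq, hφ, Equiv.symm_apply_apply]
  have hev : ∀ᶠ n in (U : Filter ℕ), lo x y ≤ ‖f n x - f n y‖ ∧ ‖f n x - f n y‖ ≤ hi x y := by
    filter_upwards [hU (hB x), hU (hB y)] with n hx hy using hf n x hx y hy
  exact ⟨ge_of_tendsto hnorm (hev.mono fun _ h => h.1),
    le_of_tendsto hnorm (hev.mono fun _ h => h.2)⟩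

namespace IsWordMetric

variable {G : Type*} [Group G] [MetricSpace G] {S : Finset G}

theorem dist_mul_left_s1 (h : IsWordMetric G S) (k x y : G) : dist (k * x) (k * y) = dist x y := by
  rw [h.2, h.2]
  simp [mul_assoc]

theorem exists_word_s1 (h : IsWordMetric G S) (x : G) :
    ∃ l : List G, (∀ s ∈ l, s ∈ S ∨ s⁻¹ ∈ S) ∧ l.prod = x := by
  have hx : x ∈ Subgroup.closure (S : Set G) := h.1 ▸ Subgroup.mem_top x
  rw [← Subgroup.mem_toSubmonoid, Subgroup.closure_toSubmonoid] at hx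
  simpa using Submonoid.exists_list_of_mem_closure hx

theorem exists_word_length_lt (h : IsWordMetric G S) {x : G} {r : ℝ} (hr : dist 1 x < r) :
    ∃ l : List G, (∀ s ∈ l, s ∈ S ∨ s⁻¹ ∈ S) ∧ l.prod = x ∧ (l.length : ℝ) < r := by
  rw [h.2] at hr
  obtain ⟨l, hl, hx⟩ := h.exists_word_s1 x
  obtain ⟨_, ⟨m, hm, hmx, rfl⟩, hlt⟩ := exists_lt_of_csInf_lt
    (by exact ⟨(l.length : ℝ), l, hl, by simpa using hx, rfl⟩) hr
  exact ⟨m, hm, by simpa using hmx, hlt⟩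

theorem finite_ball (h : IsWordMetric G S) (r : ℝ) : {x : G | dist 1 x < r}.Finite := by
  have hA : {s : G | s ∈ S ∨ s⁻¹ ∈ S}.Finite :=
    S.finite_toSet.union (S.finite_toSet.preimage inv_injective.injOn)
  have := hA.to_subtype
  refine ((List.finite_length_le {s : G | s ∈ S ∨ s⁻¹ ∈ S} ⌈r⌉₊).image
    fun l => (l.map Subtype.val).prod).subset fun x hx => ?_
  obtain ⟨l, hl, rfl, hlt⟩ := h.exists_word_length_lt hx
  lift l to List {s : G | s ∈ S ∨ s⁻¹ ∈ S} using hl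
  refine ⟨l, ?_, rfl⟩
  have : (l.length : ℝ) < ⌈r⌉₊ := by simpa using hlt.trans_le (Nat.le_ceil r)
  exact_mod_cast this.le

theorem countable (h : IsWordMetric G S) : Countable G := by
  rw [← Set.countable_univ_iff]
  refine (Set.countable_iUnion fun n : ℕ => (h.finite_ball n).countable).mono fun x _ => ?_
  exact Set.mem_iUnion.mpr (exists_nat_gt (dist 1 x))

/-- A filtration eventually avoids the nontrivial elements of any ball. -/
theorem eventually_forall_mem_eq_one (h : IsWordMetric G S) {N : ℕ → Subgroup G}
    (hanti : Antitone N) (hinter : ⨅ n, N n = ⊥) (r : ℝ) :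
    ∀ᶠ n in atTop, ∀ c ∈ N n, dist 1 c < r → c = 1 := by
  suffices ∀ᶠ n in atTop, ∀ c ∈ {x : G | dist 1 x < r}, c ∈ N n → c = 1 from
    this.mono fun n hn c hc hr => hn c hr hc
  refine (h.finite_ball r).eventually_all.mpr fun c _ => ?_
  by_cases hc : c = 1
  · exact .of_forall fun _ _ => hc
  obtain ⟨m, hm⟩ : ∃ m, c ∉ N m := by
    by_contra! hall
    have : c ∈ ⨅ n, N n := by simpa [Subgroup.mem_iInf] using hall
    exact hc (by simpa [hinter] using this)
  filter_upwards [eventually_ge_atTop m] with n hn hcn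
  exact absurd (hanti hn hcn) hm

/-- The quotient map by a normal subgroup without short nontrivial elements preserves small
distances. -/
theorem sInf_dist_coset_eq (h : IsWordMetric G S) (M : Subgroup G) [M.Normal] {r : ℝ}
    (hM : ∀ c ∈ M, dist 1 c < 2 * r → c = 1) {x y : G} (hxy : dist x y ≤ r) :
    sInf {t : ℝ | ∃ a ∈ M, ∃ b ∈ M, t = dist (x * a) (y * b)} = dist x y := by
  refine IsLeast.csInf_eq ⟨⟨1, M.one_mem, 1, M.one_mem, by simp⟩, ?_⟩
  rintro _ ⟨a, ha, b, hb, rfl⟩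
  by_contra! hlt
  set w := x⁻¹ * y with hw
  have hc : w⁻¹ * a⁻¹ * w * b ∈ M := by
    have := ‹M.Normal›.conj_mem a⁻¹ (M.inv_mem ha) w⁻¹
    rw [inv_inv] at this
    exact M.mul_mem this hb
  have hwd : dist 1 w = dist x y := by
    rw [← h.dist_mul_left_s1 x]; simp [hw]
  have hwc : dist 1 (w * (w⁻¹ * a⁻¹ * w * b)) = dist (x * a) (y * b) := by
    rw [← h.dist_mul_left_s1 (x * a)]; simp [hw, mul_assoc]
  have hc1 : w⁻¹ * a⁻¹ * w * b = 1 := by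
    refine hM _ hc ?_
    have h1 := h.dist_mul_left_s1 w 1 (w⁻¹ * a⁻¹ * w * b)
    have h2 := dist_triangle_left (w * 1) (w * (w⁻¹ * a⁻¹ * w * b)) 1
    rw [mul_one] at h1 h2
    linarith
  rw [hc1, mul_one, hwd] at hwc
  exact hlt.ne hwc.symm

end IsWordMetric

/-- In a coarse disjoint union, a bounded set meets only finitely many blocks. -/
theorem eventually_mk_notMem_of_isBounded {Q : ℕ → Type*} [MetricSpace ((n : ℕ) × Q n)]
    (hsep : ∀ M : ℝ, ∃ n₀ : ℕ, ∀ i j : ℕ, i ≠ j → n₀ ≤ i + j → ∀ (x : Q i) (y : Q j),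
      M ≤ dist (⟨i, x⟩ : (n : ℕ) × Q n) ⟨j, y⟩)
    {K : Set ((n : ℕ) × Q n)} (hK : IsBounded K) :
    ∀ᶠ n in atTop, ∀ x : Q n, (⟨n, x⟩ : (n : ℕ) × Q n) ∉ K := by
  rcases K.eq_empty_or_nonempty with rfl | ⟨⟨j, y⟩, hp⟩
  · simp
  obtain ⟨M, hM⟩ := hK.subset_closedBall ⟨j, y⟩
  obtain ⟨n₀, hn₀⟩ := hsep (M + 1)
  filter_upwards [eventually_ge_atTop n₀, eventually_gt_atTop j] with n hn hj x hx
  have h1 := hn₀ n j hj.ne' (by omega) x y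
  have h2 := mem_closedBall.mp (hM hx)
  linarith

/-- Theorem 2.3, (2) ⇒ (1): if for some filtration `(N n)` of a finitely generated
residually finite group `Γ` the box space `⊔ₙ Γ/Γₙ` admits a coarse embedding at infinity
into Hilbert space, then `Γ` (with the word metric of a finite generating set) admits a
coarse embedding into a real Hilbert space. -/
theorem coarse_emb_of_box_space_coarse_emb_at_infinity
    {Γ : Type*} [Group Γ] [MetricSpace Γ] (S : Finset Γ) (hword : IsWordMetric Γ S)
    -- a filtration of Γ
    (N : ℕ → Subgroup Γ) [∀ n, (N n).Normal] [∀ n, (N n).FiniteIndex]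
    (hanti : Antitone N) (hinter : (⨅ n, N n) = ⊥)
    -- the box space: a metric on the disjoint union of the quotients
    [MetricSpace ((n : ℕ) × (Γ ⧸ N n))]
    -- whose restriction to each block is the quotient metric
    (hrest : ∀ (n : ℕ) (g h : Γ),
      dist (⟨n, QuotientGroup.mk g⟩ : (n : ℕ) × (Γ ⧸ N n)) ⟨n, QuotientGroup.mk h⟩ =
        sInf {r : ℝ | ∃ a ∈ N n, ∃ b ∈ N n, r = dist (g * a) (h * b)})
    -- and whose blocks drift apart towards infinity
    (hsep : ∀ M : ℝ, ∃ n₀ : ℕ, ∀ i j : ℕ, i ≠ j → n₀ ≤ i + j →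
      ∀ (x : Γ ⧸ N i) (y : Γ ⧸ N j),
        M ≤ dist (⟨i, x⟩ : (n : ℕ) × (Γ ⧸ N n)) ⟨j, y⟩)
    (hbox : CoarseEmbAtInfinityHilbert ((n : ℕ) × (Γ ⧸ N n))) :
    CoarseEmbHilbert Γ := by
  obtain ⟨ρm, ρp, hm, hp, hmt, -, hR⟩ := hbox
  have := hword.countable
  obtain ⟨H, i₁, i₂, i₃, f, hf⟩ := exists_limit_map_hilbert (X := Γ)
    (fun x y => ρm (dist x y)) (fun x y => ρp (dist x y)) (fun k => {x | dist 1 x < k})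
    (fun x => by
      filter_upwards [tendsto_natCast_atTop_atTop.eventually_gt_atTop (dist 1 x)] with n hn
        using hn)
    (fun k => by
      obtain ⟨K, hK, hC⟩ := hR (2 * k + 1) (by positivity)
      obtain ⟨n, hn₁, hn₂⟩ :=
        ((hword.eventually_forall_mem_eq_one hanti hinter (2 * (2 * k))).and
          (eventually_mk_notMem_of_isBounded hsep hK)).exists
      let π (x : Γ) : (n : ℕ) × (Γ ⧸ N n) := ⟨n, QuotientGroup.mk x⟩
      have hsmall {x y : Γ} (hx : dist 1 x < k) (hy : dist 1 y < k) : dist x y ≤ 2 * k := by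
        have := dist_triangle_left x y 1
        linarith
      have hπ {x y : Γ} (hx : dist 1 x < k) (hy : dist 1 y < k) :
          dist (π x) (π y) = dist x y := by
        rw [hrest]
        exact hword.sInf_dist_coset_eq (N n) hn₁ (hsmall hx hy)
      obtain ⟨H, j₁, j₂, -, f, hf⟩ := hC (π '' {x | dist 1 x < k})
        ((hword.finite_ball k).image π).isBounded
        (by rintro _ ⟨x, -, rfl⟩; exact hn₂ _)
        (diam_le_of_forall_dist_le (by positivity) (by
          rintro _ ⟨x, hx, rfl⟩ _ ⟨y, hy, rfl⟩
          rw [hπ hx hy]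
          exact (hsmall hx hy).trans (by linarith)))
      classical
      refine ⟨H, j₁, j₂, fun x => if hx : dist 1 x < k then f ⟨π x, Set.mem_image_of_mem π hx⟩ else 0,
        fun x hx y hy => ?_⟩
      rw [Set.mem_ofPred_eq] at hx hy
      simp only [dif_pos hx, dif_pos hy, ← hπ hx hy]
      exact hf ⟨π x, Set.mem_image_of_mem π hx⟩ ⟨π y, Set.mem_image_of_mem π hy⟩)
  exact ⟨H, i₁, i₂, i₃, f, ρm, ρp, hm, hp, hmt, hf⟩
end

section
/- Let X be a uniformly discrete metric space with bounded geometry. If X has Property A at infinity, then X admits a coarse embedding at infinity into Hilbert space. -/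
open Metric Bornology Filter

/-- Pillon's Property A at infinity: for all `R, ε > 0` there is `S ≥ 0` such that for every
`L ≥ 0` there is a finite `K ⊆ X` such that every finite `C ⊆ X \ K` of diameter at most `L`
carries unit vectors `ξ_x ∈ ℓ²(C)` (`x ∈ C`) with `|1 - ⟨ξ_x, ξ_y⟩| ≤ ε` whenever
`d(x,y) ≤ R`, and `supp ξ_x ⊆ B(x, S) ∩ C`. -/
def PropertyAAtInfinity (X : Type*) [MetricSpace X] : Prop :=
  ∀ R : ℝ, 0 < R → ∀ ε : ℝ, 0 < ε → ∃ S : ℝ, 0 ≤ S ∧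
    ∀ L : ℝ, 0 ≤ L → ∃ K : Finset X,
      ∀ C : Finset X, (↑C : Set X) ⊆ (↑K : Set X)ᶜ → diam (↑C : Set X) ≤ L →
        ∃ ξ : X → X → ℝ,
          (∀ x ∈ C, ∑ z ∈ C, (ξ x z) ^ 2 = 1) ∧
          (∀ x ∈ C, ∀ y ∈ C, dist x y ≤ R → |1 - ∑ z ∈ C, ξ x z * ξ y z| ≤ ε) ∧
          (∀ x ∈ C, ∀ z : X, ξ x z ≠ 0 → z ∈ C ∧ dist x z ≤ S)

/-- Property A at infinity, at scale `n + 1` and precision `2⁻ⁿ` for all `n < N` at once, stated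
through squared distances. -/
theorem PropertyAAtInfinity.exists_scales {X : Type*} [MetricSpace X]
    (hA : PropertyAAtInfinity X) :
    ∃ S : ℕ → ℝ, ∀ (N : ℕ) (L : ℝ), 0 ≤ L → ∃ K : Finset X,
      ∀ C : Finset X, (↑C : Set X) ⊆ (↑K : Set X)ᶜ → diam (↑C : Set X) ≤ L →
        ∃ ξ : ℕ → X → X → ℝ, ∀ n < N, ∀ x ∈ C, ∀ y ∈ C,
          (2 * S n < dist x y → ∑ z ∈ C, (ξ n x z - ξ n y z) ^ 2 = 2) ∧
          ∑ z ∈ C, (ξ n x z - ξ n y z) ^ 2 ≤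
            (if (n : ℝ) + 1 < dist x y then 4 else 0) + 2 * (1 / 2 : ℝ) ^ n := by
  classical
  choose S _ hS using fun n : ℕ => hA (n + 1) (by positivity) ((1 / 2 : ℝ) ^ n) (by positivity)
  refine ⟨S, fun N L hL => ?_⟩
  choose K hK using fun n => hS n L hL
  refine ⟨(Finset.range N).biUnion K, fun C hCK hCL => ?_⟩
  have hsub (n : ℕ) (hn : n < N) : (↑C : Set X) ⊆ (↑(K n) : Set X)ᶜ := fun x hx hxK =>
    hCK hx (Finset.mem_coe.2 (Finset.mem_biUnion.2 ⟨n, Finset.mem_range.2 hn, hxK⟩))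
  have key (n : ℕ) : ∃ ξ : X → X → ℝ, n < N → ∀ x ∈ C, ∀ y ∈ C,
      (2 * S n < dist x y → ∑ z ∈ C, (ξ x z - ξ y z) ^ 2 = 2) ∧
      ∑ z ∈ C, (ξ x z - ξ y z) ^ 2 ≤
        (if (n : ℝ) + 1 < dist x y then 4 else 0) + 2 * (1 / 2 : ℝ) ^ n := by
    by_cases hn : n < N
    swap
    · exact ⟨fun _ _ => 0, fun h => absurd h hn⟩
    obtain ⟨ξ, hunit, hclose, hsupp⟩ := hK n C (hsub n hn) hCL
    refine ⟨ξ, fun _ x hx y hy => ?_⟩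
    have hexp : ∑ z ∈ C, (ξ x z - ξ y z) ^ 2 = 2 - 2 * ∑ z ∈ C, ξ x z * ξ y z := by
      have : ∀ z ∈ C, (ξ x z - ξ y z) ^ 2 = ξ x z ^ 2 + ξ y z ^ 2 - 2 * (ξ x z * ξ y z) :=
        fun z _ => by ring
      rw [Finset.sum_congr rfl this, Finset.sum_sub_distrib, Finset.sum_add_distrib,
        hunit x hx, hunit y hy, ← Finset.mul_sum]
      norm_num
    constructor
    · intro hd
      have hzero : ∑ z ∈ C, ξ x z * ξ y z = 0 := by
        refine Finset.sum_eq_zero fun z _ => ?_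
        by_contra hne
        have h1 := (hsupp x hx z (left_ne_zero_of_mul hne)).2
        have h2 := (hsupp y hy z (right_ne_zero_of_mul hne)).2
        linarith [dist_triangle_right x y z]
      rw [hexp, hzero]
      norm_num
    · split_ifs with hd
      · have hle : ∑ z ∈ C, (ξ x z - ξ y z) ^ 2 ≤ ∑ z ∈ C, (2 * ξ x z ^ 2 + 2 * ξ y z ^ 2) :=
          Finset.sum_le_sum fun z _ => by nlinarith [sq_nonneg (ξ x z + ξ y z)]
        rw [Finset.sum_add_distrib, ← Finset.mul_sum, ← Finset.mul_sum, hunit x hx,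
          hunit y hy] at hle
        have : (0 : ℝ) ≤ (1 / 2 : ℝ) ^ n := by positivity
        linarith
      · rw [hexp]
        linarith [(abs_le.1 (hclose x hx y hy (not_lt.1 hd))).2]
  choose ξ hξ using key
  exact ⟨ξ, hξ⟩

/-- The number of scales `n < t` whose support radius `S n` is less than `t / 2` is monotone
in `t`. -/
theorem monotone_card_scales (S : ℕ → ℝ) :
    Monotone fun t : ℝ => ((Finset.range ⌈t⌉₊).filter fun n => 2 * S n < t).card := by
  intro s t hst
  refine Finset.card_le_card fun n hn => ?_
  simp only [Finset.mem_filter, Finset.mem_range] at hn ⊢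
  exact ⟨hn.1.trans_le (Nat.ceil_mono hst), hn.2.trans_le hst⟩

/-- The number of scales `n < t` whose support radius `S n` is less than `t / 2` grows to
infinity with `t`. -/
theorem tendsto_card_scales (S : ℕ → ℝ) :
    Tendsto (fun t : ℝ => ((Finset.range ⌈t⌉₊).filter fun n => 2 * S n < t).card)
      atTop atTop := by
  refine tendsto_atTop.2 fun m => ?_
  have h : ∀ᶠ t : ℝ in atTop, ∀ n ∈ Finset.range m, 2 * S n < t :=
    (Filter.eventually_all_finset _).2 fun n _ => eventually_gt_atTop _
  filter_upwards [h, eventually_ge_atTop (m : ℝ)] with t ht hmt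
  calc m = (Finset.range m).card := (Finset.card_range m).symm
    _ ≤ _ := Finset.card_le_card fun n hn => by
      have hn' := Finset.mem_range.1 hn
      have hm : m ≤ ⌈t⌉₊ := by exact_mod_cast hmt.trans (Nat.le_ceil t)
      exact Finset.mem_filter.2 ⟨Finset.mem_range.2 (hn'.trans_le hm), ht n hn⟩

/-- A finite family of maps into `ℓ²(C)` assembles into a map to a Hilbert space in `Type`
whose squared distances are the sums of the squared distances of the family. -/
theorem exists_hilbert_map_norm_sub_sq {X : Type*} (C : Finset X) (N : ℕ) (ξ : ℕ → X → X → ℝ) :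
    ∃ (k : ℕ) (f : X → EuclideanSpace ℝ (Fin N × Fin k)), ∀ x y : X,
      ‖f x - f y‖ ^ 2 = ∑ n ∈ Finset.range N, ∑ z ∈ C, (ξ n x z - ξ n y z) ^ 2 := by
  refine ⟨C.card, fun x => WithLp.toLp 2 fun p => ξ p.1 x (C.equivFin.symm p.2), fun x y => ?_⟩
  rw [EuclideanSpace.norm_sq_eq, Fintype.sum_prod_type, Finset.sum_range]
  refine Finset.sum_congr rfl fun n _ => ?_
  rw [← Finset.sum_coe_sort C, ← C.equivFin.symm.sum_comp]
  simp

/-- Example 2.6: a uniformly discrete metric space of bounded geometry with Property A at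
infinity admits a coarse embedding at infinity into Hilbert space. -/
theorem coarse_emb_at_infinity_of_propertyA_at_infinity
    {X : Type*} [MetricSpace X]
    (hdiscrete : ∃ δ : ℝ, 0 < δ ∧ ∀ x y : X, x ≠ y → δ ≤ dist x y)
    (hbddgeom : ∀ r : ℝ, 0 < r → ∃ M : ℕ, ∀ x : X,
      (Metric.closedBall x r).Finite ∧ (Metric.closedBall x r).ncard ≤ M)
    (hA : PropertyAAtInfinity X) :
    CoarseEmbAtInfinityHilbert X := by
  obtain ⟨S, hS⟩ := hA.exists_scales
  refine ⟨fun t => √((Finset.range ⌈t⌉₊).filter fun n => 2 * S n < t).card,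
    fun t => √(4 * ⌈t⌉₊ + 4), ?_, ?_, ?_, ?_, fun L hL => ?_⟩
  · exact fun s t hst => Real.sqrt_le_sqrt (by exact_mod_cast monotone_card_scales S hst)
  · exact fun s t hst => Real.sqrt_le_sqrt (by gcongr)
  · exact Real.tendsto_sqrt_atTop.comp
      (tendsto_natCast_atTop_atTop.comp (tendsto_card_scales S))
  · refine Real.tendsto_sqrt_atTop.comp (tendsto_atTop_mono (fun t => ?_) tendsto_id)
    have := Nat.le_ceil t
    have h0 : (0 : ℝ) ≤ ⌈t⌉₊ := Nat.cast_nonneg _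
    simp only [id]
    linarith
  obtain ⟨K, hK⟩ := hS ⌈L⌉₊ L hL.le
  refine ⟨K, K.finite_toSet.isBounded, fun C hCb hCK hCL => ?_⟩
  have hCfin : C.Finite := by
    rcases C.eq_empty_or_nonempty with rfl | ⟨c, hc⟩
    · exact Set.finite_empty
    · obtain ⟨M, hM⟩ := hbddgeom L hL
      exact (hM c).1.subset fun x hx =>
        mem_closedBall.2 ((dist_le_diam_of_mem hCb hx hc).trans hCL)
  lift C to Finset X using hCfin
  obtain ⟨ξ, hξ⟩ := hK C hCK hCL
  obtain ⟨k, f, hf⟩ := exists_hilbert_map_norm_sub_sq C ⌈L⌉₊ ξ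
  refine ⟨_, inferInstance, inferInstance, inferInstance, fun x => f x, ?_⟩
  rintro ⟨x, hx⟩ ⟨y, hy⟩
  have hx' : x ∈ C := hx
  have hy' : y ∈ C := hy
  have hdL : dist x y ≤ L := (dist_le_diam_of_mem hCb hx hy).trans hCL
  constructor
  · refine Real.sqrt_le_iff.2 ⟨norm_nonneg _, ?_⟩
    rw [hf]
    set A := (Finset.range ⌈dist x y⌉₊).filter fun n => 2 * S n < dist x y
    have hsub : A ⊆ Finset.range ⌈L⌉₊ := (Finset.filter_subset _ _).trans
      (Finset.range_subset_range.2 (Nat.ceil_mono hdL))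
    calc (A.card : ℝ) = ∑ n ∈ A, (1 : ℝ) := by simp
      _ ≤ ∑ n ∈ A, ∑ z ∈ C, (ξ n x z - ξ n y z) ^ 2 := Finset.sum_le_sum fun n hn => by
          rw [(hξ n (Finset.mem_range.1 (hsub hn)) x hx' y hy').1 (Finset.mem_filter.1 hn).2]
          norm_num
      _ ≤ _ := Finset.sum_le_sum_of_subset_of_nonneg hsub fun n _ _ =>
          Finset.sum_nonneg fun z _ => sq_nonneg _
  · refine Real.le_sqrt_of_sq_le ?_
    rw [hf]
    calc ∑ n ∈ Finset.range ⌈L⌉₊, ∑ z ∈ C, (ξ n x z - ξ n y z) ^ 2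
        ≤ ∑ n ∈ Finset.range ⌈L⌉₊,
            ((if (n : ℝ) + 1 < dist x y then 4 else 0) + 2 * (1 / 2 : ℝ) ^ n) :=
          Finset.sum_le_sum fun n hn => (hξ n (Finset.mem_range.1 hn) x hx' y hy').2
      _ ≤ 4 * ⌈dist x y⌉₊ + 4 := by
          rw [Finset.sum_add_distrib, ← Finset.mul_sum, ← Finset.sum_filter,
            Finset.sum_const, nsmul_eq_mul]
          have hcard : ((Finset.range ⌈L⌉₊).filter fun n : ℕ => (n : ℝ) + 1 < dist x y).card
              ≤ ⌈dist x y⌉₊ := by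
            refine (Finset.card_le_card fun n hn => ?_).trans_eq (Finset.card_range _)
            refine Finset.mem_range.2 (Nat.lt_ceil.2 ?_)
            linarith [(Finset.mem_filter.1 hn).2]
          have hcard' : (((Finset.range ⌈L⌉₊).filter
              fun n : ℕ => (n : ℝ) + 1 < dist x y).card : ℝ) ≤ ⌈dist x y⌉₊ := by
            exact_mod_cast hcard
          have hgeom : ∑ n ∈ Finset.range ⌈L⌉₊, (1 / 2 : ℝ) ^ n ≤ 2 := sum_geometric_two_le _
          linarith
end

section
/- Let (1 → Nₙ → Gₙ → Qₙ → 1)ₙ be a sequence of extensions of finite groups such that the groups Gₙ have uniformly finite generating sets (there is an integer M such that each Gₙ has a generating set Sₙ with |Sₙ| ≤ M). Equip each Gₙ with the word metric of Sₙ, each Nₙ with the metric induced from the word metric of Gₙ, and each Qₙ = Gₙ/Nₙ with the quotient metric d(gNₙ, hNₙ) = min{ d_{Gₙ}(ga, hb) : a, b ∈ Nₙ }. If the coarse disjoint union N = ⨆ₙ Nₙ admits a coarse embedding at infinity into Hilbert space and the coarse disjoint union Q = ⨆ₙ Qₙ has Property A at infinity, then the coarse disjoint union G = ⨆ₙ Gₙ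 admits a coarse embedding at infinity into Hilbert space. -/
open Metric Bornology Filter

/-- A pointwise limit of positive semidefinite real matrices is positive semidefinite. -/
theorem posSemidef_of_tendsto {T : Type*} {A : ℕ → Matrix T T ℝ} {B : Matrix T T ℝ}
    (hA : ∀ m, (A m).PosSemidef) (h : ∀ x y, Tendsto (fun m => A m x y) atTop (nhds (B x y))) :
    B.PosSemidef := by
  refine ⟨Matrix.IsHermitian.ext fun x y => ?_, fun v => ?_⟩
  · refine tendsto_nhds_unique (h y x) ((h x y).congr fun m => ?_)
    simpa using (hA m).isHermitian.apply y x
  · refine ge_of_tendsto' (x := atTop) (f := fun m =>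
      v.sum fun i xi => v.sum fun j xj => star xi * A m i j * xj) ?_ fun m => (hA m).2 v
    refine tendsto_finsetSum _ fun i _ => tendsto_finsetSum _ fun j _ => ?_
    exact ((h i j).const_mul _).mul_const _

theorem posSemidef_of_mul {T : Type*} [Finite T] (u : T → ℝ) :
    (Matrix.of fun x y => u x * u y : Matrix T T ℝ).PosSemidef := by
  have h : (Matrix.of fun x y => u x * u y : Matrix T T ℝ) = Matrix.gram ℝ u := by
    ext x y
    simp [Matrix.gram_apply, mul_comm]
  rw [h]
  exact Matrix.posSemidef_gram ℝ u

/-- The entrywise exponential of a positive semidefinite real matrix is positive semidefinite. -/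
theorem posSemidef_exp_entries {T : Type*} [Finite T] {A : Matrix T T ℝ} (hA : A.PosSemidef) :
    (Matrix.of fun x y => Real.exp (A x y)).PosSemidef := by
  have hpow : ∀ m : ℕ, (Matrix.of fun x y => A x y ^ m).PosSemidef := by
    intro m
    induction m with
    | zero => simpa using posSemidef_of_mul (fun _ : T => (1 : ℝ))
    | succ m ih =>
      have h : (Matrix.of fun x y => A x y ^ (m + 1)) =
          (Matrix.of fun x y => A x y ^ m).hadamard A := by
        ext x y
        simp [pow_succ]
      rw [h]
      exact ih.hadamard hA
  refine posSemidef_of_tendsto (A := fun m => ∑ i ∈ Finset.range m,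
    ((i.factorial : ℝ)⁻¹) • (Matrix.of fun x y => A x y ^ i))
    (fun m => Matrix.posSemidef_sum _ fun i _ => (hpow i).smul (by positivity)) fun x y => ?_
  have h := (NormedSpace.expSeries_div_hasSum_exp (A x y)).tendsto_sum_nat
  rw [← Real.exp_eq_exp_ℝ] at h
  refine h.congr fun m => ?_
  simp [Matrix.sum_apply, div_eq_inv_mul]

/-- The Gaussian kernel on a real Hilbert space is positive semidefinite. -/
theorem posSemidef_gaussian {T H : Type*} [Finite T] [NormedAddCommGroup H] [InnerProductSpace ℝ H]
    (f : T → H) {t : ℝ} (ht : 0 ≤ t) :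
    (Matrix.of fun x y => Real.exp (-(t * ‖f x - f y‖ ^ 2))).PosSemidef := by
  have hg : ((2 * t) • Matrix.gram ℝ f).PosSemidef :=
    (Matrix.posSemidef_gram ℝ f).smul (by positivity)
  have h : (Matrix.of fun x y => Real.exp (-(t * ‖f x - f y‖ ^ 2))) =
      (Matrix.of fun x y => Real.exp (-(t * ‖f x‖ ^ 2)) * Real.exp (-(t * ‖f y‖ ^ 2))).hadamard
        (Matrix.of fun x y => Real.exp (((2 * t) • Matrix.gram ℝ f) x y)) := by
    ext x y
    simp only [Matrix.of_apply, Matrix.hadamard_apply, Matrix.smul_apply, Matrix.gram_apply,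
      smul_eq_mul, ← Real.exp_add, norm_sub_sq_real]
    congr 1
    ring
  rw [h]
  exact (posSemidef_of_mul fun x => Real.exp (-(t * ‖f x‖ ^ 2))).hadamard
    (posSemidef_exp_entries hg)

/-- A positive semidefinite real matrix is the Gram matrix of vectors in a Euclidean space. -/
theorem exists_gram_eq_of_posSemidef {T : Type*} [Finite T] {A : Matrix T T ℝ}
    (hA : A.PosSemidef) :
    ∃ (m : ℕ) (f : T → EuclideanSpace ℝ (Fin m)), ∀ x y, A x y = inner ℝ (f x) (f y) := by
  obtain ⟨m, v, rfl⟩ := Matrix.posSemidef_iff_eq_sum_vecMulVec.mp hA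
  refine ⟨m, fun x => WithLp.toLp 2 fun i => v i x, fun x y => ?_⟩
  simp [Matrix.sum_apply, Matrix.vecMulVec_apply, PiLp.inner_apply, mul_comm]

/-- A bounded subset of a coarse disjoint union meets only finitely many of the pieces. -/
theorem exists_forall_notMem_of_isBounded {X : ℕ → Type*} [MetricSpace ((n : ℕ) × X n)]
    (hsep : ∀ M : ℝ, ∃ n₀ : ℕ, ∀ i j : ℕ, i ≠ j → n₀ ≤ i + j →
      ∀ (x : X i) (y : X j), M ≤ dist (⟨i, x⟩ : (n : ℕ) × X n) ⟨j, y⟩)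
    {K : Set ((n : ℕ) × X n)} (hK : IsBounded K) :
    ∃ n₀ : ℕ, ∀ n ≥ n₀, ∀ x : X n, (⟨n, x⟩ : (n : ℕ) × X n) ∉ K := by
  rcases K.eq_empty_or_nonempty with rfl | ⟨⟨i, p⟩, hp⟩
  · exact ⟨0, fun _ _ _ => Set.notMem_empty _⟩
  obtain ⟨n₀, hn₀⟩ := hsep (diam K + 1)
  refine ⟨max n₀ (i + 1), fun n hn x hx => ?_⟩
  have h1 := hn₀ i n (by omega) (by omega) p x
  have h2 := dist_le_diam_of_mem hK hp hx
  linarith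

/-- A coarse disjoint union which coarsely embeds at infinity into Hilbert space carries, far
out, positive definite kernels which are close to `1` near the diagonal and at most `1 / 2` far
from it. -/
theorem CoarseEmbAtInfinityHilbert.exists_kernel {X : ℕ → Type*} [MetricSpace ((n : ℕ) × X n)]
    (hsep : ∀ M : ℝ, ∃ n₀ : ℕ, ∀ i j : ℕ, i ≠ j → n₀ ≤ i + j →
      ∀ (x : X i) (y : X j), M ≤ dist (⟨i, x⟩ : (n : ℕ) × X n) ⟨j, y⟩)
    (hX : CoarseEmbAtInfinityHilbert ((n : ℕ) × X n)) (r : ℝ) {ε : ℝ} (hε : 0 < ε) :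
    ∃ L : ℝ, ∀ R : ℝ, ∃ n₀ : ℕ, ∀ n ≥ n₀, ∀ (T : Type) [Finite T] (φ : T → X n),
      (∀ s t, dist (⟨n, φ s⟩ : (n : ℕ) × X n) ⟨n, φ t⟩ ≤ R) →
      ∃ K : Matrix T T ℝ, K.PosSemidef ∧ (∀ s, K s s = 1) ∧ (∀ s t, 0 ≤ K s t ∧ K s t ≤ 1) ∧
        (∀ s t, dist (⟨n, φ s⟩ : (n : ℕ) × X n) ⟨n, φ t⟩ ≤ r → 1 - K s t ≤ ε) ∧
        (∀ s t, L ≤ dist (⟨n, φ s⟩ : (n : ℕ) × X n) ⟨n, φ t⟩ → K s t ≤ 1 / 2) := by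
  obtain ⟨ρm, ρp, -, hρp, hρm', -, hemb⟩ := hX
  set a : ℝ := ε / (ρp r ^ 2 + 1) with ha
  have ha0 : 0 < a := by positivity
  obtain ⟨L, hL⟩ := eventually_atTop.1 (hρm'.eventually_ge_atTop (1 / a + 1))
  refine ⟨L, fun R => ?_⟩
  obtain ⟨K, hK, hC⟩ := hemb (max R 1) (by positivity)
  obtain ⟨n₀, hn₀⟩ := exists_forall_notMem_of_isBounded hsep hK
  refine ⟨n₀, fun n hn T _ φ hφ => ?_⟩
  set C : Set ((n : ℕ) × X n) := Set.range fun s : T => (⟨n, φ s⟩ : (n : ℕ) × X n) with hCdef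
  have hCd : diam C ≤ max R 1 := by
    refine diam_le_of_forall_dist_le (by positivity) ?_
    rintro _ ⟨s, rfl⟩ _ ⟨t, rfl⟩
    exact (hφ s t).trans (le_max_left _ _)
  obtain ⟨H, _, _, _, f, hf⟩ := hC C (Set.finite_range _).isBounded
    (by rintro _ ⟨s, rfl⟩; exact hn₀ n hn _) hCd
  set g : T → H := fun s => f ⟨⟨n, φ s⟩, s, rfl⟩ with hg
  have hfg : ∀ s t, ρm (dist (⟨n, φ s⟩ : (n : ℕ) × X n) ⟨n, φ t⟩) ≤ ‖g s - g t‖ ∧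
      ‖g s - g t‖ ≤ ρp (dist (⟨n, φ s⟩ : (n : ℕ) × X n) ⟨n, φ t⟩) := fun s t =>
    hf ⟨⟨n, φ s⟩, s, rfl⟩ ⟨⟨n, φ t⟩, t, rfl⟩
  refine ⟨_, posSemidef_gaussian g ha0.le, fun s => by simp, fun s t => ⟨?_, ?_⟩,
    fun s t hst => ?_, fun s t hst => ?_⟩
  · exact (Real.exp_pos _).le
  · exact Real.exp_le_one_iff.2 (neg_nonpos.2 (by positivity))
  · have h1 : ‖g s - g t‖ ≤ ρp r := (hfg s t).2.trans (hρp hst)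
    have h2 : ‖g s - g t‖ ^ 2 ≤ ρp r ^ 2 := by gcongr
    have h3 : a * ‖g s - g t‖ ^ 2 ≤ ε := by
      rw [ha, div_mul_eq_mul_div, div_le_iff₀ (by positivity)]
      nlinarith
    have h4 := Real.add_one_le_exp (-(a * ‖g s - g t‖ ^ 2))
    simp only [Matrix.of_apply]
    linarith
  · have h1 : 1 / a + 1 ≤ ‖g s - g t‖ := (hL _ hst).trans (hfg s t).1
    have h0 : 0 < 1 / a := by positivity
    have h2 : 1 / a ≤ ‖g s - g t‖ ^ 2 := by nlinarith
    have h3 : 1 ≤ a * ‖g s - g t‖ ^ 2 := by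
      rwa [div_le_iff₀' ha0] at h2
    have h4 := Real.add_one_le_exp (a * ‖g s - g t‖ ^ 2)
    simp only [Matrix.of_apply, Real.exp_neg]
    rw [inv_le_comm₀ (Real.exp_pos _) (by norm_num)]
    norm_num
    linarith

/-- A coarse disjoint union of finite metric spaces which carries, far out and at every scale,
positive definite kernels which are close to `1` near the diagonal and at most `1 / 2` far from
it coarsely embeds at infinity into Hilbert space. -/
theorem coarseEmbAtInfinityHilbert_of_kernels {X : ℕ → Type} [∀ n, Finite (X n)]
    [MetricSpace ((n : ℕ) × X n)]
    (hsep : ∀ M : ℝ, ∃ n₀ : ℕ, ∀ i j : ℕ, i ≠ j → n₀ ≤ i + j →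
      ∀ (x : X i) (y : X j), M ≤ dist (⟨i, x⟩ : (n : ℕ) × X n) ⟨j, y⟩)
    (hker : ∀ r ε : ℝ, 0 < r → 0 < ε →
      ∃ L : ℝ, ∀ R : ℝ, ∃ n₀ : ℕ, ∀ n ≥ n₀, ∀ (T : Type) [Finite T] (φ : T → X n),
      (∀ s t, dist (⟨n, φ s⟩ : (n : ℕ) × X n) ⟨n, φ t⟩ ≤ R) →
      ∃ K : Matrix T T ℝ, K.PosSemidef ∧ (∀ s, K s s = 1) ∧ (∀ s t, |K s t| ≤ 1) ∧
        (∀ s t, dist (⟨n, φ s⟩ : (n : ℕ) × X n) ⟨n, φ t⟩ ≤ r → 1 - K s t ≤ ε) ∧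
        (∀ s t, L ≤ dist (⟨n, φ s⟩ : (n : ℕ) × X n) ⟨n, φ t⟩ → K s t ≤ 1 / 2)) :
    CoarseEmbAtInfinityHilbert ((n : ℕ) × X n) := by
  have hk : ∀ k : ℕ, _ := fun k => hker (k + 1) ((1 / 2) ^ k) (by positivity) (by positivity)
  choose L' hL' using hk
  choose n₀ hn₀ using hL'
  set L : ℕ → ℝ := fun k => max (L' k) k with hL
  have hfin : ∀ t : ℝ, {k : ℕ | L k ≤ t}.Finite := fun t =>
    (Set.finite_Iic ⌈t⌉₊).subset fun k (hk : L k ≤ t) => by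
      have h1 : (k : ℝ) ≤ t := (le_max_right _ _).trans hk
      exact_mod_cast h1.trans (Nat.le_ceil t)
  refine ⟨fun t => √({k : ℕ | L k ≤ t}.ncard : ℝ), fun t => 4 * max t 0 + 8, ?_, ?_, ?_, ?_, ?_⟩
  · intro s t hst
    refine Real.sqrt_le_sqrt (Nat.cast_le.2 (Set.ncard_le_ncard ?_ (hfin t)))
    exact fun k (hk : L k ≤ s) => hk.trans hst
  · intro s t hst
    have := max_le_max_right 0 hst
    change 4 * max s 0 + 8 ≤ 4 * max t 0 + 8
    linarith
  · refine Real.tendsto_sqrt_atTop.comp (tendsto_natCast_atTop_atTop.comp ?_)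
    refine tendsto_atTop.2 fun m => ?_
    obtain ⟨B, hB⟩ := ((Finset.range m).image L).bddAbove
    filter_upwards [eventually_ge_atTop B] with t ht
    calc m = (↑(Finset.range m) : Set ℕ).ncard := by simp
      _ ≤ _ := Set.ncard_le_ncard (fun k hk => ?_) (hfin t)
    exact (hB (Finset.mem_coe.2 (Finset.mem_image_of_mem L (Finset.mem_coe.1 hk)))).trans ht
  · refine tendsto_atTop_mono (fun t => ?_) tendsto_id
    have := le_max_left t 0
    have := le_max_right t 0
    simp only [id]
    linarith
  intro R hR
  obtain ⟨m₀, hm₀⟩ := hsep (R + 1)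
  set k₀ : ℕ := ⌈R⌉₊ + 1 with hk₀
  set m : ℕ := max m₀ ((Finset.range k₀).sup fun k => n₀ k R) with hm
  refine ⟨{p | p.1 < m}, ?_, fun C hCb hCK hCR => ?_⟩
  · have hfinK : {p : (n : ℕ) × X n | p.1 < m} ⊆
        ⋃ n ∈ Finset.range m, Set.range (Sigma.mk n : X n → (n : ℕ) × X n) := by
      rintro ⟨n, x⟩ hx
      simp only [Set.mem_iUnion]
      exact ⟨n, Finset.mem_range.2 hx, x, rfl⟩
    exact (Set.Finite.subset (Set.Finite.biUnion (Finset.finite_toSet _)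
      fun n _ => Set.finite_range _) hfinK).isBounded
  rcases C.eq_empty_or_nonempty with rfl | ⟨⟨n, p⟩, hp⟩
  · exact ⟨ℝ, inferInstance, inferInstance, inferInstance, fun _ => 0,
      fun x => absurd x.2 (Set.notMem_empty _)⟩
  have hmn : m ≤ n := by simpa using hCK hp
  have hfib : ∀ x : C, ∃ y : X n, (x : (n : ℕ) × X n) = ⟨n, y⟩ := by
    rintro ⟨⟨i, x⟩, hx⟩
    have hi : i = n := by
      by_contra hne
      have h1 := hm₀ i n hne (by omega) x p
      have h2 := dist_le_diam_of_mem hCb hx hp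
      linarith
    subst hi
    exact ⟨x, rfl⟩
  choose φ hφ using hfib
  have hφinj : Function.Injective φ := fun x y hxy =>
    Subtype.ext (by rw [hφ x, hφ y, hxy])
  have : Finite C := Finite.of_injective φ hφinj
  have hdist : ∀ x y : C, dist (⟨n, φ x⟩ : (n : ℕ) × X n) ⟨n, φ y⟩ =
      dist (x : (n : ℕ) × X n) y := fun x y => by rw [← hφ, ← hφ]
  have hdR : ∀ x y : C, dist (x : (n : ℕ) × X n) y ≤ R := fun x y =>
    (dist_le_diam_of_mem hCb x.2 y.2).trans hCR
  have hn₀n : ∀ k ∈ Finset.range k₀, n₀ k R ≤ n := fun k hk =>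
    (Finset.le_sup (f := fun k => n₀ k R) hk).trans ((le_max_right _ _).trans hmn)
  have hker' : ∀ k : ℕ, ∃ K : Matrix C C ℝ, k ∈ Finset.range k₀ →
      K.PosSemidef ∧ (∀ s, K s s = 1) ∧ (∀ s t, |K s t| ≤ 1) ∧
        (∀ s t : C, dist (s : (n : ℕ) × X n) t ≤ k + 1 → 1 - K s t ≤ (1 / 2) ^ k) ∧
        (∀ s t : C, L' k ≤ dist (s : (n : ℕ) × X n) t → K s t ≤ 1 / 2) := by
    intro k
    by_cases hk : k ∈ Finset.range k₀
    · obtain ⟨K, hK⟩ := hn₀ k R n (hn₀n k hk) C φ fun s t => by rw [hdist]; exact hdR s t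
      simp only [hdist] at hK
      exact ⟨K, fun _ => hK⟩
    · exact ⟨0, fun h => absurd h hk⟩
  choose K hK using hker'
  obtain ⟨d, f, hf⟩ := exists_gram_eq_of_posSemidef
    (Matrix.posSemidef_sum (Finset.range k₀) fun k hk => (hK k hk).1)
  refine ⟨EuclideanSpace ℝ (Fin d), inferInstance, inferInstance, inferInstance, f,
    fun x y => ?_⟩
  have hnorm : ‖f x - f y‖ ^ 2 = ∑ k ∈ Finset.range k₀, 2 * (1 - K k x y) := by
    rw [norm_sub_sq_real, ← real_inner_self_eq_norm_sq, ← real_inner_self_eq_norm_sq,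
      ← hf, ← hf, ← hf]
    simp only [Matrix.sum_apply, Finset.mul_sum]
    rw [← Finset.sum_sub_distrib, ← Finset.sum_add_distrib]
    refine Finset.sum_congr rfl fun k hk => ?_
    rw [(hK k hk).2.1, (hK k hk).2.1]
    ring
  have hnn : ∀ k ∈ Finset.range k₀, 0 ≤ 2 * (1 - K k x y) := fun k hk => by
    have := (abs_le.1 ((hK k hk).2.2.1 x y)).2
    linarith
  set δ := dist (x : (n : ℕ) × X n) y with hδ
  have hδ0 : 0 ≤ δ := dist_nonneg
  constructor
  · refine Real.sqrt_le_iff.2 ⟨norm_nonneg _, ?_⟩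
    rw [hnorm, Set.ncard_eq_toFinset_card _ (hfin δ)]
    have hsub : (hfin δ).toFinset ⊆ Finset.range k₀ := fun k hk => by
      have h1 : L k ≤ δ := by simpa using hk
      have h2 : (k : ℝ) ≤ R := (le_max_right _ _).trans (h1.trans (hdR x y))
      have h3 : k ≤ ⌈R⌉₊ := by exact_mod_cast h2.trans (Nat.le_ceil R)
      exact Finset.mem_range.2 (by omega)
    calc ((hfin δ).toFinset.card : ℝ) = ∑ k ∈ (hfin δ).toFinset, (1 : ℝ) := by simp
      _ ≤ ∑ k ∈ (hfin δ).toFinset, 2 * (1 - K k x y) := Finset.sum_le_sum fun k hk => by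
        have h1 : L k ≤ δ := by simpa using hk
        have := (hK k (hsub hk)).2.2.2.2 x y ((le_max_left _ _).trans h1)
        linarith
      _ ≤ _ := Finset.sum_le_sum_of_subset_of_nonneg hsub fun k hk _ => hnn k hk
  · change _ ≤ 4 * max δ 0 + 8
    rw [max_eq_left hδ0]
    refine (pow_le_pow_iff_left₀ (norm_nonneg _) (by positivity) two_ne_zero).1 ?_
    have hle : ‖f x - f y‖ ^ 2 ≤ 4 * δ + 8 := by
      rw [hnorm]
      calc ∑ k ∈ Finset.range k₀, 2 * (1 - K k x y)
          ≤ ∑ k ∈ Finset.range k₀, ((if k < ⌈δ⌉₊ then 4 else 0) + 2 * (1 / 2 : ℝ) ^ k) := by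
            refine Finset.sum_le_sum fun k hk => ?_
            have hp : (0 : ℝ) ≤ (1 / 2) ^ k := by positivity
            split_ifs with h
            · have := (abs_le.1 ((hK k hk).2.2.1 x y)).1
              linarith
            · have h1 : δ ≤ k + 1 := (Nat.le_ceil δ).trans
                ((Nat.cast_le.2 (not_lt.1 h)).trans (by linarith))
              have := (hK k hk).2.2.2.1 x y h1
              linarith
        _ ≤ 4 * (δ + 1) + 2 * 2 := by
            rw [Finset.sum_add_distrib, ← Finset.mul_sum]
            refine add_le_add ?_ ?_
            · rw [← Finset.sum_filter, Finset.sum_const, nsmul_eq_mul, mul_comm]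
              refine mul_le_mul_of_nonneg_left ?_ (by norm_num)
              have h1 : ((Finset.range k₀).filter (· < ⌈δ⌉₊)).card ≤ ⌈δ⌉₊ := by
                calc _ ≤ (Finset.range ⌈δ⌉₊).card := Finset.card_le_card fun k hk => by
                      simpa using (Finset.mem_filter.1 hk).2
                  _ = _ := Finset.card_range _
              exact (Nat.cast_le.2 h1).trans (Nat.ceil_lt_add_one hδ0).le
            · refine mul_le_mul_of_nonneg_left ?_ (by norm_num)
              exact (Summable.sum_le_tsum _ (fun k _ => by positivity)
                summable_geometric_two).trans_eq tsum_geometric_two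
        _ = 4 * δ + 8 := by ring
    nlinarith

theorem IsWordMetric.dist_mul_left_s5 {G : Type*} [Group G] [MetricSpace G] {S : Finset G}
    (h : IsWordMetric G S) (a x y : G) : dist (a * x) (a * y) = dist x y := by
  rw [h.2, h.2]
  simp [mul_assoc]

theorem sum_abs_mul_le_one {ι : Type*} (s : Finset ι) {u v : ι → ℝ}
    (hu : ∑ i ∈ s, u i ^ 2 = 1) (hv : ∑ i ∈ s, v i ^ 2 = 1) : ∑ i ∈ s, |u i * v i| ≤ 1 := by
  have h : ∑ i ∈ s, |u i * v i| ≤ ∑ i ∈ s, (u i ^ 2 + v i ^ 2) / 2 :=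
    Finset.sum_le_sum fun i _ => abs_le.2
      ⟨by linarith [sq_nonneg (u i + v i)], by linarith [sq_nonneg (u i - v i)]⟩
  rw [← Finset.sum_div, Finset.sum_add_distrib, hu, hv] at h
  linarith

/-- A sum of entrywise products bounded by a constant on the common support of two unit vectors
is bounded by the same constant. -/
theorem abs_sum_mul_mul_le {ι : Type*} (s : Finset ι) {u v w : ι → ℝ} {B : ℝ} (hB : 0 ≤ B)
    (hu : ∑ i ∈ s, u i ^ 2 = 1) (hv : ∑ i ∈ s, v i ^ 2 = 1)
    (hw : ∀ i ∈ s, u i ≠ 0 → v i ≠ 0 → |w i| ≤ B) : |∑ i ∈ s, u i * v i * w i| ≤ B := by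
  calc |∑ i ∈ s, u i * v i * w i| ≤ ∑ i ∈ s, |u i * v i * w i| := Finset.abs_sum_le_sum_abs _ _
    _ ≤ ∑ i ∈ s, |u i * v i| * B := Finset.sum_le_sum fun i hi => by
      rw [abs_mul]
      by_cases h1 : u i = 0
      · simp [h1]
      by_cases h2 : v i = 0
      · simp [h2]
      exact mul_le_mul_of_nonneg_left (hw i hi h1 h2) (abs_nonneg _)
    _ ≤ 1 * B := by
      rw [← Finset.sum_mul]
      exact mul_le_mul_of_nonneg_right (sum_abs_mul_le_one s hu hv) hB
    _ = B := one_mul B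

section Quotient

variable {G : Type*} [Group G] [MetricSpace G] {N : Subgroup G} [MetricSpace (G ⧸ N)]

theorem dist_mk_le_of_quotient_dist
    (hquot : ∀ g h : G, dist (QuotientGroup.mk g : G ⧸ N) (QuotientGroup.mk h) =
      sInf {r : ℝ | ∃ a ∈ N, ∃ b ∈ N, r = dist (g * a) (h * b)}) (x y : G) :
    dist (QuotientGroup.mk x : G ⧸ N) (QuotientGroup.mk y) ≤ dist x y := by
  rw [hquot]
  refine csInf_le ⟨0, ?_⟩ ⟨1, N.one_mem, 1, N.one_mem, by simp⟩
  rintro _ ⟨a, -, b, -, rfl⟩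
  exact dist_nonneg

/-- Distances in the quotient of a finite group by a normal subgroup are realised by lifts of
the second point, for any lift of the first one. -/
theorem exists_mk_eq_dist_le_of_quotient_dist [Finite G] [hN : N.Normal]
    (hinv : ∀ a x y : G, dist (a * x) (a * y) = dist x y)
    (hquot : ∀ g h : G, dist (QuotientGroup.mk g : G ⧸ N) (QuotientGroup.mk h) =
      sInf {r : ℝ | ∃ a ∈ N, ∃ b ∈ N, r = dist (g * a) (h * b)}) (x : G) (q : G ⧸ N) :
    ∃ y : G, (QuotientGroup.mk y : G ⧸ N) = q ∧
      dist x y ≤ dist (QuotientGroup.mk x : G ⧸ N) q := by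
  obtain ⟨h, rfl⟩ := QuotientGroup.mk_surjective q
  have hfin : {r : ℝ | ∃ a ∈ N, ∃ b ∈ N, r = dist (x * a) (h * b)}.Finite :=
    (Set.finite_range fun p : G × G => dist (x * p.1) (h * p.2)).subset fun r hr => by
      obtain ⟨a, -, b, -, rfl⟩ := hr
      exact ⟨(a, b), rfl⟩
  have hne : {r : ℝ | ∃ a ∈ N, ∃ b ∈ N, r = dist (x * a) (h * b)}.Nonempty :=
    ⟨_, 1, N.one_mem, 1, N.one_mem, rfl⟩
  obtain ⟨a, ha, b, hb, hab⟩ := hne.csInf_mem hfin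
  refine ⟨(x * a * x⁻¹)⁻¹ * (h * b), ?_, ?_⟩
  · refine (QuotientGroup.eq.2 ?_).symm
    have h1 := hN.conj_mem _ (N.inv_mem (hN.conj_mem a ha x)) h⁻¹
    convert N.mul_mem h1 hb using 1
    group
  · rw [hquot, hab, ← hinv (x * a * x⁻¹)]
    simp [mul_assoc]

end Quotient

/-- Proposition 2.7: for a sequence of extensions `1 → Nₙ → Gₙ → Qₙ → 1` of finite groups
with uniformly finite generating sets, if the coarse disjoint union of the `Nₙ` (with the
induced metrics) coarsely embeds at infinity into Hilbert space and the coarse disjoint union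
of the `Qₙ` (with the quotient metrics) has Property A at infinity, then the coarse disjoint
union of the `Gₙ` coarsely embeds at infinity into Hilbert space. -/
theorem coarse_emb_at_infinity_of_extension
    (G : ℕ → Type) [∀ n, Group (G n)] [∀ n, Finite (G n)]
    (N : ∀ n, Subgroup (G n)) [∀ n, (N n).Normal]
    -- uniformly finite generating sets and the word metrics
    (M : ℕ) (S : ∀ n, Finset (G n)) (hcard : ∀ n, (S n).card ≤ M)
    [∀ n, MetricSpace (G n)] (hword : ∀ n, IsWordMetric (G n) (S n))
    -- the quotient metrics on Qₙ = Gₙ/Nₙ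
    [∀ n, MetricSpace (G n ⧸ N n)]
    (hquot : ∀ (n : ℕ) (g h : G n),
      dist (QuotientGroup.mk g : G n ⧸ N n) (QuotientGroup.mk h) =
        sInf {r : ℝ | ∃ a ∈ N n, ∃ b ∈ N n, r = dist (g * a) (h * b)})
    -- the coarse disjoint union of the Gₙ
    [MetricSpace ((n : ℕ) × G n)]
    (hGrest : ∀ (n : ℕ) (x y : G n),
      dist (⟨n, x⟩ : (n : ℕ) × G n) ⟨n, y⟩ = dist x y)
    (hGsep : ∀ M' : ℝ, ∃ n₀ : ℕ, ∀ i j : ℕ, i ≠ j → n₀ ≤ i + j →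
      ∀ (x : G i) (y : G j), M' ≤ dist (⟨i, x⟩ : (n : ℕ) × G n) ⟨j, y⟩)
    -- the coarse disjoint union of the Nₙ (each Nₙ carries the metric induced from Gₙ)
    [MetricSpace ((n : ℕ) × ↥(N n))]
    (hNrest : ∀ (n : ℕ) (x y : ↥(N n)),
      dist (⟨n, x⟩ : (n : ℕ) × ↥(N n)) ⟨n, y⟩ = dist (x : G n) (y : G n))
    (hNsep : ∀ M' : ℝ, ∃ n₀ : ℕ, ∀ i j : ℕ, i ≠ j → n₀ ≤ i + j →
      ∀ (x : ↥(N i)) (y : ↥(N j)), M' ≤ dist (⟨i, x⟩ : (n : ℕ) × ↥(N n)) ⟨j, y⟩)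
    -- the coarse disjoint union of the Qₙ
    [MetricSpace ((n : ℕ) × (G n ⧸ N n))]
    (hQrest : ∀ (n : ℕ) (x y : G n ⧸ N n),
      dist (⟨n, x⟩ : (n : ℕ) × (G n ⧸ N n)) ⟨n, y⟩ = dist x y)
    (hQsep : ∀ M' : ℝ, ∃ n₀ : ℕ, ∀ i j : ℕ, i ≠ j → n₀ ≤ i + j →
      ∀ (x : G i ⧸ N i) (y : G j ⧸ N j),
        M' ≤ dist (⟨i, x⟩ : (n : ℕ) × (G n ⧸ N n)) ⟨j, y⟩)
    -- the hypotheses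
    (hN : CoarseEmbAtInfinityHilbert ((n : ℕ) × ↥(N n)))
    (hQ : PropertyAAtInfinity ((n : ℕ) × (G n ⧸ N n))) :
    CoarseEmbAtInfinityHilbert ((n : ℕ) × G n) := by
  have hinv : ∀ n, ∀ a x y : G n, dist (a * x) (a * y) = dist x y :=
    fun n => (hword n).dist_mul_left_s5
  refine coarseEmbAtInfinityHilbert_of_kernels hGsep fun r ε hr hε => ?_
  obtain ⟨D, hD0, hD⟩ := hQ r hr (ε / 2) (by positivity)
  obtain ⟨L, hL⟩ := hN.exists_kernel hNsep (r + 2 * D) (half_pos hε)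
  refine ⟨L + 2 * D, fun R => ?_⟩
  obtain ⟨KQ, hKQ⟩ := hD (max R 0) (le_max_right _ _)
  obtain ⟨n₁, hn₁⟩ := exists_forall_notMem_of_isBounded hQsep KQ.finite_toSet.isBounded
  obtain ⟨n₂, hn₂⟩ := hL (R + 2 * max R 0)
  refine ⟨max n₁ n₂, fun n hn T _ φ hφ => ?_⟩
  simp only [hGrest] at hφ ⊢
  simp only [hNrest] at hn₂
  set p : T → (n : ℕ) × (G n ⧸ N n) := fun s => ⟨n, QuotientGroup.mk (φ s)⟩ with hp
  have hpd : ∀ s t, dist (p s) (p t) ≤ dist (φ s) (φ t) := fun s t =>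
    (hQrest n _ _).trans_le (dist_mk_le_of_quotient_dist (hquot n) _ _)
  set C : Finset ((n : ℕ) × (G n ⧸ N n)) := (Set.finite_range p).toFinset with hC
  have hpC : ∀ s, p s ∈ C := fun s => by simp [hC]
  have hCp : ∀ q ∈ C, ∃ s, p s = q := fun q hq => by simpa [hC] using hq
  obtain ⟨ξ, hξ1, hξ2, hξ3⟩ := hKQ C
    (fun q hq => by
      obtain ⟨s, rfl⟩ := hCp q hq
      exact hn₁ n (le_of_max_le_left hn) _)
    (by
      refine diam_le_of_forall_dist_le (le_max_right _ _) fun a ha b hb => ?_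
      obtain ⟨s, rfl⟩ := hCp a ha
      obtain ⟨t, rfl⟩ := hCp b hb
      exact ((hpd s t).trans (hφ s t)).trans (le_max_left _ _))
  have hker : ∀ q, ∃ (k : Matrix T T ℝ) (τ : T → G n), q ∈ C →
      k.PosSemidef ∧ (∀ s, k s s = 1) ∧ (∀ s t, 0 ≤ k s t ∧ k s t ≤ 1) ∧
        (∀ s t, dist (τ s) (τ t) ≤ r + 2 * D → 1 - k s t ≤ ε / 2) ∧
        (∀ s t, L ≤ dist (τ s) (τ t) → k s t ≤ 1 / 2) ∧
        ∀ s, dist (φ s) (τ s) ≤ dist (p s) q := by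
    intro q
    by_cases hq : q ∈ C
    swap
    · exact ⟨0, φ, fun h => absurd h hq⟩
    obtain ⟨c, rfl⟩ := hCp q hq
    -- choose nearest points in the coset of `φ c` and translate them into the subgroup
    have hlift : ∀ s : T, ∃ y : G n, (QuotientGroup.mk y : G n ⧸ N n) = QuotientGroup.mk (φ c) ∧
        dist (φ s) y ≤ dist (p s) (p c) := fun s => by
      rw [hQrest]
      exact exists_mk_eq_dist_le_of_quotient_dist (hinv n) (hquot n) _ _
    choose τ hτ hτd using hlift
    have hmem : ∀ s, (φ c)⁻¹ * τ s ∈ N n := fun s => QuotientGroup.eq.1 (hτ s).symm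
    have hτR : ∀ s, dist (φ s) (τ s) ≤ max R 0 := fun s =>
      (hτd s).trans (((hpd s c).trans (hφ s c)).trans (le_max_left _ _))
    obtain ⟨k, hk⟩ := hn₂ n (le_of_max_le_right hn) T (fun s => ⟨(φ c)⁻¹ * τ s, hmem s⟩)
      fun s t => by
        have h1 := dist_triangle4_left (φ s) (φ t) (τ s) (τ t)
        have h2 := hτR s
        have h3 := hτR t
        have h4 := hφ s t
        simp only [hinv]
        linarith
    simp only [hinv] at hk
    exact ⟨k, τ, fun _ => ⟨hk.1, hk.2.1, hk.2.2.1, hk.2.2.2.1, hk.2.2.2.2, hτd⟩⟩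
  choose k τ hkτ using hker
  have hone : ∀ s, ∑ q ∈ C, ξ (p s) q ^ 2 = 1 := fun s => hξ1 _ (hpC s)
  have hsupp : ∀ q ∈ C, ∀ s, ξ (p s) q ≠ 0 → dist (φ s) (τ q s) ≤ D := fun q hq s h =>
    ((hkτ q hq).2.2.2.2.2 s).trans (hξ3 _ (hpC s) q h).2
  refine ⟨∑ q ∈ C, (Matrix.of fun s t => ξ (p s) q * ξ (p t) q).hadamard (k q),
    Matrix.posSemidef_sum _ fun q hq => (posSemidef_of_mul _).hadamard (hkτ q hq).1, ?_⟩
  simp only [Matrix.sum_apply, Matrix.hadamard_apply, Matrix.of_apply]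
  refine ⟨fun s => ?_, fun s t => ?_, fun s t hst => ?_, fun s t hst => ?_⟩
  · rw [← hone s]
    refine Finset.sum_congr rfl fun q hq => ?_
    rw [(hkτ q hq).2.1, mul_one, sq]
  · refine abs_sum_mul_mul_le C zero_le_one (hone s) (hone t) fun q hq _ _ => ?_
    have h := (hkτ q hq).2.2.1 s t
    exact abs_le.2 ⟨by linarith [h.1], h.2⟩
  · have h1 := (abs_le.1 (hξ2 _ (hpC s) _ (hpC t) ((hpd s t).trans hst))).2
    have h2 : |∑ q ∈ C, ξ (p s) q * ξ (p t) q * (1 - k q s t)| ≤ ε / 2 := by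
      refine abs_sum_mul_mul_le C (half_pos hε).le (hone s) (hone t) fun q hq hs ht => ?_
      have h := ((hkτ q hq).2.2.1 s t).2
      rw [abs_of_nonneg (by linarith)]
      refine (hkτ q hq).2.2.2.1 s t ?_
      have h3 := dist_triangle4_left (φ s) (φ t) (τ q s) (τ q t)
      linarith [hsupp q hq s hs, hsupp q hq t ht]
    have h3 : ∑ q ∈ C, ξ (p s) q * ξ (p t) q * (1 - k q s t) =
        ∑ q ∈ C, ξ (p s) q * ξ (p t) q - ∑ q ∈ C, ξ (p s) q * ξ (p t) q * k q s t := by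
      rw [← Finset.sum_sub_distrib]
      exact Finset.sum_congr rfl fun q _ => by ring
    rw [h3] at h2
    linarith [(abs_le.1 h2).2]
  · refine (le_abs_self _).trans
      (abs_sum_mul_mul_le C (by norm_num) (hone s) (hone t) fun q hq hs ht => ?_)
    rw [abs_of_nonneg ((hkτ q hq).2.2.1 s t).1]
    refine (hkτ q hq).2.2.2.2.1 s t ?_
    have h3 := dist_triangle4_right (φ s) (φ t) (τ q s) (τ q t)
    linarith [hsupp q hq s hs, hsupp q hq t ht]
end

section
/- Let X be a metric space and let ρ : [0,∞) → [0,∞) be a non-decreasing function with ρ(t) → ∞ as t → ∞. Assume there exists a sequence of positive reals (Rₙ) increasing to infinity such that for every n and every real i ≥ Rₙ there exists a bounded subset K_{n,i} ⊆ X with the following property: for every subset C ⊆ X \ K_{n,i} with diam(C) ≤ i there exist a real Hilbert space H and a map f : C → H such that ‖f(x) − f(y)‖ ≤ ρ(d(x,y)) for all x, y ∈ C, and ‖f(x) − f(y)‖ ≥ n whenever x, y ∈ C with d(x,y) ≥ Rₙ. Then X admits a coarse embedding at infinity into Hilbert space. -/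
open Metric Bornology Filter

/-- A finite family of maps into Hilbert spaces, all bounded by `b`, can be combined with
geometrically decaying weights into one map bounded by `2 * b` that dominates each weighted
member of the family. -/
theorem exists_hilbert_weighted_sum {α : Type*} {N : ℕ} (H : Fin N → Type)
    [∀ k, NormedAddCommGroup (H k)] [∀ k, InnerProductSpace ℝ (H k)]
    [∀ k, CompleteSpace (H k)] (f : ∀ k, α → H k) (b : α → α → ℝ)
    (hb : ∀ x y, 0 ≤ b x y) (hf : ∀ k x y, ‖f k x - f k y‖ ≤ b x y) :
    ∃ (E : Type) (_ : NormedAddCommGroup E) (_ : InnerProductSpace ℝ E)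
      (_ : CompleteSpace E) (g : α → E), ∀ x y,
        ‖g x - g y‖ ≤ 2 * b x y ∧
        ∀ k : Fin N, (1 / 2 : ℝ) ^ (k : ℕ) * ‖f k x - f k y‖ ≤ ‖g x - g y‖ := by
  let g : α → PiLp 2 H := fun x => WithLp.toLp 2 fun k => (1 / 2 : ℝ) ^ (k : ℕ) • f k x
  have hg : ∀ x y k, ‖(g x - g y) k‖ = (1 / 2 : ℝ) ^ (k : ℕ) * ‖f k x - f k y‖ := by
    intro x y k
    have : (g x - g y) k = (1 / 2 : ℝ) ^ (k : ℕ) • (f k x - f k y) := by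
      simp [g, smul_sub]
    rw [this, norm_smul, Real.norm_of_nonneg (by positivity)]
  refine ⟨PiLp 2 H, inferInstance, inferInstance, inferInstance, g, fun x y => ⟨?_, fun k => ?_⟩⟩
  · refine le_of_sq_le_sq ?_ (mul_nonneg zero_le_two (hb x y))
    have hgeom : ∑ k : Fin N, (1 / 4 : ℝ) ^ (k : ℕ) ≤ 4 := by
      rw [Fin.sum_univ_eq_sum_range (fun k => (1 / 4 : ℝ) ^ k)]
      refine ((summable_geometric_of_lt_one (by norm_num) (by norm_num)).sum_le_tsum _
        fun k _ => by positivity).trans ?_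
      rw [tsum_geometric_of_lt_one (by norm_num) (by norm_num)]
      norm_num
    calc ‖g x - g y‖ ^ 2 = ∑ k, ‖(g x - g y) k‖ ^ 2 := PiLp.norm_sq_eq_of_L2 _ _
      _ ≤ ∑ k : Fin N, (1 / 4 : ℝ) ^ (k : ℕ) * b x y ^ 2 := by
          refine Finset.sum_le_sum fun k _ => ?_
          rw [hg, mul_pow, ← pow_mul, mul_comm (k : ℕ) 2, pow_mul]
          have := hf k x y
          norm_num
          gcongr
      _ = (∑ k : Fin N, (1 / 4 : ℝ) ^ (k : ℕ)) * b x y ^ 2 := by rw [Finset.sum_mul]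
      _ ≤ 4 * b x y ^ 2 := by gcongr
      _ = (2 * b x y) ^ 2 := by ring
  · rw [← hg]
    exact PiLp.norm_apply_le _ k

/-- Lemma 3.3: a gluing criterion for coarse embeddability at infinity into Hilbert space. -/
theorem coarse_emb_at_infinity_of_uniform_separation {X : Type*} [MetricSpace X]
    (ρ : ℝ → ℝ) (hρ : Monotone ρ) (hρ_top : Tendsto ρ atTop atTop)
    (Rseq : ℕ → ℝ) (hRpos : ∀ n, 0 < Rseq n) (hRmono : Monotone Rseq)
    (hRtop : Tendsto Rseq atTop atTop)
    (h : ∀ n : ℕ, ∀ i : ℝ, Rseq n ≤ i →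
      ∃ K : Set X, IsBounded K ∧
        ∀ C : Set X, IsBounded C → C ⊆ Kᶜ → diam C ≤ i →
          ∃ (H : Type) (_ : NormedAddCommGroup H) (_ : InnerProductSpace ℝ H)
            (_ : CompleteSpace H) (f : C → H),
            (∀ x y : C, ‖f x - f y‖ ≤ ρ (dist (x : X) (y : X))) ∧
            (∀ x y : C, Rseq n ≤ dist (x : X) (y : X) → (n : ℝ) ≤ ‖f x - f y‖)) :
    CoarseEmbAtInfinityHilbert X := by
  have hpow : Tendsto (fun k : ℕ => 4 ^ k) atTop atTop :=
    tendsto_pow_atTop_atTop_of_one_lt (by norm_num)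
  have hbdd : ∀ t : ℝ, ∃ N : ℕ, ∀ k, Rseq (4 ^ k) ≤ t → k < N := by
    intro t
    obtain ⟨N, hN⟩ := eventually_atTop.1 ((hRtop.comp hpow).eventually_gt_atTop t)
    exact ⟨N, fun k hk => not_le.1 fun hNk => (hN k hNk).not_ge hk⟩
  have hBdd : ∀ t : ℝ, BddAbove {k : ℕ | Rseq (4 ^ k) ≤ t} := fun t =>
    let ⟨N, hN⟩ := hbdd t
    ⟨N, fun k hk => (hN k hk).le⟩
  refine ⟨fun t => (sSup {k : ℕ | Rseq (4 ^ k) ≤ t} : ℕ), fun t => 2 * max (ρ t) 0,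
    ?_, ?_, ?_, ?_, ?_⟩
  · intro s t hst
    exact Nat.cast_le.2 (csSup_le_csSup' (hBdd t) fun k (hk : Rseq (4 ^ k) ≤ s) => hk.trans hst)
  · intro s t hst
    have := hρ hst
    dsimp only
    gcongr
  · refine tendsto_natCast_atTop_atTop.comp (tendsto_atTop.2 fun k => ?_)
    filter_upwards [eventually_ge_atTop (Rseq (4 ^ k))] with t ht
    exact le_csSup (hBdd t) ht
  · exact (tendsto_atTop_mono (fun t => le_max_left _ _) hρ_top).const_mul_atTop two_pos
  · intro R _
    obtain ⟨N, hN⟩ := hbdd R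
    choose K hK hC using fun k : Fin N => h (4 ^ (k : ℕ)) (max R (Rseq (4 ^ (k : ℕ))))
      (le_max_right _ _)
    refine ⟨⋃ k, K k, isBounded_iUnion.2 hK, fun C hCb hCK hCR => ?_⟩
    choose H i₁ i₂ i₃ f hf hsep using fun k => hC k C hCb
      (hCK.trans (Set.compl_subset_compl.2 (Set.subset_iUnion K k))) (hCR.trans (le_max_left _ _))
    obtain ⟨E, j₁, j₂, j₃, g, hg⟩ := exists_hilbert_weighted_sum H f
      (fun x y => max (ρ (dist (x : X) (y : X))) 0) (fun _ _ => le_max_right _ _)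
      (fun k x y => (hf k x y).trans (le_max_left _ _))
    refine ⟨E, j₁, j₂, j₃, g, fun x y => ⟨?_, (hg x y).1⟩⟩
    dsimp only
    rcases Set.eq_empty_or_nonempty {k : ℕ | Rseq (4 ^ k) ≤ dist (x : X) (y : X)} with he | hne
    · simp [he]
    have hm := Nat.sSup_mem hne (hBdd _)
    set m := sSup {k : ℕ | Rseq (4 ^ k) ≤ dist (x : X) (y : X)}
    replace hm : Rseq (4 ^ m) ≤ dist (x : X) (y : X) := hm
    have hmN : m < N := hN m (hm.trans ((dist_le_diam_of_mem hCb x.2 y.2).trans hCR))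
    have hfm : (4 : ℝ) ^ m ≤ ‖f ⟨m, hmN⟩ x - f ⟨m, hmN⟩ y‖ := by
      simpa using hsep ⟨m, hmN⟩ x y hm
    calc (m : ℝ) ≤ 2 ^ m := by exact_mod_cast Nat.lt_two_pow_self.le
      _ = (1 / 2) ^ m * 4 ^ m := by rw [← mul_pow]; norm_num
      _ ≤ (1 / 2) ^ m * ‖f ⟨m, hmN⟩ x - f ⟨m, hmN⟩ y‖ := by gcongr
      _ ≤ ‖g x - g y‖ := (hg x y).2 ⟨m, hmN⟩
end

section
/- Fix 1 ≤ p < ∞ and a family (Y_ι)_{ι∈I} of metric spaces. Let X be a metric space which is an (Y, p)-generalized expander at infinity: there exist c > 0 and sequences of positive reals (r_m) and (R_m) increasing to infinity such that for every bounded subset K ⊆ X and every m there exist a finite subset C ⊆ X \ K with diam(C) ≤ r_m and a probability measure μ on C × C with μ(x,y) = μ(y,x), μ(x,y) = 0 whenever d(x,y) ≤ R_m, and such that for every index ι and every map f : C → Y_ι with d(f(x), f(y)) ≤ d(x,y) for all x, y ∈ C one has ∑_{x,y∈C} d(f(x), f(y))^p μ(x,y) ≤ c. Then X does not admit a coarse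 embedding at infinity into the family (Y_ι): there do not exist non-decreasing functions ρ₋, ρ₊ : [0,∞) → [0,∞) with ρ₋(t) → ∞ as t → ∞ such that for every R > 0 there is a bounded subset K ⊆ X such that every bounded subset C ⊆ X \ K with diam(C) ≤ R admits some ι ∈ I and a map f : C → Y_ι with ρ₋(d(x,y)) ≤ d(f(x), f(y)) ≤ min(d(x,y), ρ₊(d(x,y))) for all x, y ∈ C. -/
open Metric Bornology Filter

/-- `X` is an `(M, p)`-generalized expander at infinity with respect to the family of metric
spaces `Y ι`: there are `c > 0` and sequences `r m, R m ↗ ∞` such that arbitrarily far from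
every bounded set there are finite subsets `C` of diameter at most `r m` carrying symmetric
probability measures `μ` supported at distance `> R m` from the diagonal, with
`∑ d(f x, f y)^p μ(x,y) ≤ c` for every `1`-Lipschitz map `f : C → Y ι` and every `ι`. -/
def FamilyGenExpanderAtInfinity {I : Type*} (Y : I → Type*) [∀ ι, MetricSpace (Y ι)]
    (p : ℝ) (X : Type*) [MetricSpace X] : Prop :=
  ∃ c : ℝ, 0 < c ∧ ∃ r R : ℕ → ℝ,
    (∀ m, 0 < r m) ∧ (∀ m, 0 < R m) ∧ Monotone r ∧ Monotone R ∧
    Tendsto r atTop atTop ∧ Tendsto R atTop atTop ∧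
    ∀ K : Set X, IsBounded K → ∀ m : ℕ,
      ∃ C : Finset X, (↑C : Set X) ⊆ Kᶜ ∧ diam (↑C : Set X) ≤ r m ∧
        ∃ μ : X → X → ℝ,
          (∀ x y : X, 0 ≤ μ x y) ∧
          (∑ x ∈ C, ∑ y ∈ C, μ x y = 1) ∧
          (∀ x ∈ C, ∀ y ∈ C, μ x y = μ y x) ∧
          (∀ x ∈ C, ∀ y ∈ C, dist x y ≤ R m → μ x y = 0) ∧
          (∀ (ι : I) (f : X → Y ι),
            (∀ x ∈ C, ∀ y ∈ C, dist (f x) (f y) ≤ dist x y) →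
            ∑ x ∈ C, ∑ y ∈ C, dist (f x) (f y) ^ p * μ x y ≤ c)

/-- If a nonnegative weight of total mass one on `C × C` vanishes on pairs at distance at most `R`,
and `f` sends pairs of `C` at distance greater than `R` to pairs at distance at least `a ≥ 1`, then
the weighted sum of the `p`-th powers of the distances `d(f x, f y)` is at least `a`. -/
theorem le_sum_dist_rpow_mul_of_far_support {X Z : Type*} [MetricSpace X] [MetricSpace Z]
    {p a R : ℝ} (hp : 1 ≤ p) (ha : 1 ≤ a) (C : Finset X) (μ : X → X → ℝ)
    (hμ : ∀ x y, 0 ≤ μ x y) (hsum : ∑ x ∈ C, ∑ y ∈ C, μ x y = 1)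
    (hsupp : ∀ x ∈ C, ∀ y ∈ C, dist x y ≤ R → μ x y = 0) (f : X → Z)
    (hf : ∀ x ∈ C, ∀ y ∈ C, R < dist x y → a ≤ dist (f x) (f y)) :
    a ≤ ∑ x ∈ C, ∑ y ∈ C, dist (f x) (f y) ^ p * μ x y := by
  calc a = ∑ x ∈ C, ∑ y ∈ C, a * μ x y := by
        simp_rw [← Finset.mul_sum, hsum, mul_one]
    _ ≤ ∑ x ∈ C, ∑ y ∈ C, dist (f x) (f y) ^ p * μ x y := by
        refine Finset.sum_le_sum fun x hx => Finset.sum_le_sum fun y hy => ?_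
        rcases le_or_gt (dist x y) R with h | h
        · simp [hsupp x hx y hy h]
        · have had := hf x hx y hy h
          exact mul_le_mul_of_nonneg_right
            (had.trans (Real.self_le_rpow_of_one_le (ha.trans had) hp)) (hμ x y)

/-- An `(M, p)`-generalized expander at infinity with respect to a family `(Y ι)` of metric
spaces admits no coarse embedding at infinity into the family: there are no common
controlling functions `ρ₋, ρ₊` such that all sufficiently remote bounded subsets `C` of
uniformly bounded diameter admit maps into some `Y ι` with
`ρ₋(d(x,y)) ≤ d(f x, f y) ≤ min(d(x,y), ρ₊(d(x,y)))`. -/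
theorem not_family_coarse_emb_at_infinity_of_family_gen_expander
    {X : Type*} [MetricSpace X] {I : Type*} (Y : I → Type*) [∀ ι, MetricSpace (Y ι)]
    (p : ℝ) (hp : 1 ≤ p)
    (hexp : FamilyGenExpanderAtInfinity Y p X) :
    ¬ ∃ ρm ρp : ℝ → ℝ,
        Monotone ρm ∧ Monotone ρp ∧ Tendsto ρm atTop atTop ∧
        ∀ R : ℝ, 0 < R → ∃ K : Set X, IsBounded K ∧
          ∀ C : Set X, IsBounded C → C ⊆ Kᶜ → diam C ≤ R →
            ∃ (ι : I) (f : C → Y ι),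
              ∀ x y : C, ρm (dist (x : X) (y : X)) ≤ dist (f x) (f y) ∧
                dist (f x) (f y) ≤ min (dist (x : X) (y : X)) (ρp (dist (x : X) (y : X))) := by
  classical
  rintro ⟨ρm, ρp, hmono, -, hlim, hemb⟩
  obtain ⟨c, hc, r, R, hr, -, -, -, -, hR, hexp⟩ := hexp
  obtain ⟨m, hm⟩ := ((hlim.comp hR).eventually_ge_atTop (c + 1)).exists
  obtain ⟨K, hK, hemb⟩ := hemb (r m) (hr m)
  obtain ⟨C, hCK, hCr, μ, hμ, hsum, -, hsupp, hle⟩ := hexp K hK m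
  obtain ⟨ι, f, hf⟩ := hemb C C.finite_toSet.isBounded hCK hCr
  obtain ⟨x₀, hx₀⟩ : C.Nonempty := by
    rw [Finset.nonempty_iff_ne_empty]
    rintro rfl
    simp at hsum
  let g : X → Y ι := fun x => if hx : x ∈ C then f ⟨x, hx⟩ else f ⟨x₀, hx₀⟩
  have hg : ∀ x (hx : x ∈ C), g x = f ⟨x, hx⟩ := fun x hx => dif_pos hx
  have hupper := hle ι g fun x hx y hy => by
    rw [hg x hx, hg y hy]
    exact (hf ⟨x, hx⟩ ⟨y, hy⟩).2.trans (min_le_left _ _)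
  have hlower : c + 1 ≤ ∑ x ∈ C, ∑ y ∈ C, dist (g x) (g y) ^ p * μ x y :=
    le_sum_dist_rpow_mul_of_far_support hp (by linarith) C μ hμ hsum hsupp g
      fun x hx y hy hxy => by
        rw [hg x hx, hg y hy]
        exact (hm.trans (hmono hxy.le)).trans (hf ⟨x, hx⟩ ⟨y, hy⟩).1
  linarith
end
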